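/- arXiv:hep-th/0101093 — 9 statements merged into one kernel-verified Lean document; each statement's English description precedes it below -/
import Mathlib

section
/- For every finitely generated projective right A-module Ξ there exists a finitely generated projective right A^∞-module Ξ^∞, unique up to A^∞-module isomorphism, such that Ξ is isomorphic as a right A-module to the scalar extension Ξ^∞ ⊗_{A^∞} A along the inclusion A^∞ ⊆ A. -/
/-- The subring of smooth elements of a C*-dynamical system `(A, ℝⁿ, α)`. -/
def smoothSubring {A : Type} [NormedRing A] [StarRing A] [NormedAlgebra ℂ A]
    (n : ℕ) (α : (Fin n → ℝ) → (A ≃⋆ₐ[ℂ] A)) : Subring A where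
  carrier := {x : A | ContDiff ℝ (⊤ : ℕ∞) fun g : Fin n → ℝ => α g x}
  zero_mem' := by
    have h : (fun g : Fin n → ℝ => α g 0) = fun _ => (0 : A) :=
      funext fun g => map_zero (α g)
    simpa [Set.mem_setOf_eq, h] using contDiff_const
  one_mem' := by
    have h : (fun g : Fin n → ℝ => α g 1) = fun _ => (1 : A) :=
      funext fun g => map_one (α g)
    simpa [Set.mem_setOf_eq, h] using contDiff_const
  add_mem' := by
    intro x y hx hy
    have hx' : ContDiff ℝ (⊤ : ℕ∞) fun g : Fin n → ℝ => α g x := hx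
    have hy' : ContDiff ℝ (⊤ : ℕ∞) fun g : Fin n → ℝ => α g y := hy
    have h : (fun g : Fin n → ℝ => α g (x + y))
        = fun g : Fin n → ℝ => α g x + α g y := funext fun g => map_add (α g) x y
    show ContDiff ℝ (⊤ : ℕ∞) fun g : Fin n → ℝ => α g (x + y)
    rw [h]
    exact hx'.add hy'
  neg_mem' := by
    intro x hx
    have hx' : ContDiff ℝ (⊤ : ℕ∞) fun g : Fin n → ℝ => α g x := hx
    have h : (fun g : Fin n → ℝ => α g (-x))
        = fun g : Fin n → ℝ => -(α g x) := funext fun g => map_neg (α g) x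
    show ContDiff ℝ (⊤ : ℕ∞) fun g : Fin n → ℝ => α g (-x)
    rw [h]
    exact hx'.neg
  mul_mem' := by
    intro x y hx hy
    have hx' : ContDiff ℝ (⊤ : ℕ∞) fun g : Fin n → ℝ => α g x := hx
    have hy' : ContDiff ℝ (⊤ : ℕ∞) fun g : Fin n → ℝ => α g y := hy
    have h : (fun g : Fin n → ℝ => α g (x * y))
        = fun g : Fin n → ℝ => α g x * α g y := funext fun g => map_mul (α g) x y
    show ContDiff ℝ (⊤ : ℕ∞) fun g : Fin n → ℝ => α g (x * y)
    rw [h]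
    exact hx'.mul hy'

/-- `Ξ` (a right `A`-module, encoded as a left `Aᵐᵒᵖ`-module) is the base change to `A`
of the right `S`-module `M`, expressed through the universal property of
`M ⊗_S A`: there is an `S`-linear map `j : M → Ξ` such that every `S`-linear map
from `M` to a right `A`-module extends uniquely to an `A`-linear map on `Ξ`. -/
def SmoothBaseChange {A : Type} [NormedRing A] [NormedAlgebra ℂ A] (S : Subring A)
    (M : Type) [AddCommGroup M] [Module Sᵐᵒᵖ M]
    (Ξ : Type) [AddCommGroup Ξ] [Module Aᵐᵒᵖ Ξ] : Prop :=
  ∃ j : M →+ Ξ,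
    (∀ (s : S) (m : M), j (MulOpposite.op s • m) = MulOpposite.op (s : A) • j m) ∧
    ∀ (N : Type) [AddCommGroup N] [Module Aᵐᵒᵖ N] (f : M →+ N),
      (∀ (s : S) (m : M), f (MulOpposite.op s • m) = MulOpposite.op (s : A) • f m) →
      ∃! g : Ξ →ₗ[Aᵐᵒᵖ] N, ∀ m : M, g (j m) = f m

/-- A finitely generated projective right module over the smooth subalgebra whose
base change to `A` is `Ξ`. -/
structure SmoothModel {A : Type} [NormedRing A] [NormedAlgebra ℂ A] (S : Subring A)
    (Ξ : Type) [AddCommGroup Ξ] [Module Aᵐᵒᵖ Ξ] (M : Type) where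
  [addCommGroup : AddCommGroup M]
  [module : Module Sᵐᵒᵖ M]
  finite : Module.Finite Sᵐᵒᵖ M
  projective : Module.Projective Sᵐᵒᵖ M
  baseChange : SmoothBaseChange S M Ξ

section BaseChange

variable {T R : Type} [Ring T] [Ring R] {φ : T →+* R}

/-- A `φ`-semilinear map `j : M → Ξ` exhibits `Ξ` as the base change of `M` along `φ` when every
`φ`-semilinear map out of `M` factors uniquely through it. -/
def IsUniversalExtension {M Ξ : Type} [AddCommGroup M] [Module T M] [AddCommGroup Ξ] [Module R Ξ]
    (j : M →ₛₗ[φ] Ξ) : Prop :=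
  ∀ (N : Type) [AddCommGroup N] [Module R N] (f : M →ₛₗ[φ] N),
    ∃! g : Ξ →ₗ[R] N, ∀ m, g (j m) = f m

theorem linearCombination_comp_of_semilinear {ι N : Type} [Fintype ι] [DecidableEq ι]
    [AddCommGroup N] [Module R N] (f : (ι → T) →ₛₗ[φ] N) (v : ι → T) :
    Fintype.linearCombination R (fun k => f (Pi.single k 1)) (φ ∘ v) = f v := by
  conv_rhs => rw [pi_eq_sum_univ' v, map_sum]
  rw [Fintype.linearCombination_apply]
  exact Finset.sum_congr rfl fun k _ => by
    rw [map_smulₛₗ]; rfl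

theorem linearMap_ext_of_comp {ι N : Type} [Finite ι] [AddCommGroup N] [Module R N]
    {f g : (ι → R) →ₗ[R] N} (h : ∀ v : ι → T, f (φ ∘ v) = g (φ ∘ v)) : f = g := by
  classical
  refine LinearMap.pi_ext' fun k => LinearMap.ext_ring ?_
  have hk : φ ∘ (Pi.single k 1 : ι → T) = Pi.single k 1 := by
    ext i; by_cases hi : i = k <;> simp [hi]
  simpa [hk] using h (Pi.single k 1)

theorem isUniversalExtension_of_split {ι M Ξ : Type} [Finite ι]
    [AddCommGroup M] [Module T M] [AddCommGroup Ξ] [Module R Ξ] (j : M →ₛₗ[φ] Ξ)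
    (p : (ι → T) →ₗ[T] M) (i : M →ₗ[T] ι → T) (hpi : ∀ m, p (i m) = m)
    (P : (ι → R) →ₗ[R] Ξ) (I : Ξ →ₗ[R] ι → R) (hPI : ∀ ξ, P (I ξ) = ξ)
    (hP : ∀ v, P (φ ∘ v) = j (p v)) (hI : ∀ m, I (j m) = φ ∘ i m) :
    IsUniversalExtension j := by
  classical
  have := Fintype.ofFinite ι
  intro N _ _ f
  refine ⟨Fintype.linearCombination R (fun k => f.comp p (Pi.single k 1)) ∘ₗ I, fun m => ?_,
    fun g hg => ?_⟩
  · rw [LinearMap.comp_apply, hI, linearCombination_comp_of_semilinear (f.comp p)]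
    simp [hpi]
  · have key : g ∘ₗ P = Fintype.linearCombination R (fun k => f.comp p (Pi.single k 1)) :=
      linearMap_ext_of_comp (φ := φ) fun v => by
        rw [LinearMap.comp_apply, hP, hg, linearCombination_comp_of_semilinear (f.comp p)]
        rfl
    rw [← key]
    ext ξ
    simp [hPI]

/-- Entrywise application of a ring homomorphism to a vector. -/
def compSemilinear (φ : T →+* R) (ι : Type) : (ι → T) →ₛₗ[φ] ι → R where
  toFun v := φ ∘ v
  map_add' v w := by ext; simp
  map_smul' c v := by ext; simp

theorem IsUniversalExtension.exists_split {ι M Ξ : Type} [Finite ι]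
    [AddCommGroup M] [Module T M] [AddCommGroup Ξ] [Module R Ξ] {j : M →ₛₗ[φ] Ξ}
    (hj : IsUniversalExtension j)
    (p : (ι → T) →ₗ[T] M) (i : M →ₗ[T] ι → T) (hpi : ∀ m, p (i m) = m) :
    ∃ (P : (ι → R) →ₗ[R] Ξ) (I : Ξ →ₗ[R] ι → R), (∀ ξ, P (I ξ) = ξ) ∧
      (∀ v, P (φ ∘ v) = j (p v)) ∧ ∀ m, I (j m) = φ ∘ i m := by
  classical
  have := Fintype.ofFinite ι
  obtain ⟨I, hI, -⟩ := hj (ι → R) ((compSemilinear φ ι).comp i)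
  have hP := linearCombination_comp_of_semilinear (j.comp p)
  refine ⟨_, I, fun ξ => ?_, hP, hI⟩
  have hid : ∀ m, (Fintype.linearCombination R (fun k => j.comp p (Pi.single k 1)) ∘ₗ I) (j m)
      = j m := fun m => by
    rw [LinearMap.comp_apply, hI]
    exact (hP (i m)).trans (by simp [hpi])
  exact LinearMap.congr_fun ((hj Ξ j).unique hid (fun _ => rfl : ∀ m, LinearMap.id (j m) = j m)) ξ

theorem exists_split_of_finite_projective (S M : Type) [Ring S] [AddCommGroup M] [Module S M]
    (hfin : Module.Finite S M) (hproj : Module.Projective S M) :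
    ∃ (N : ℕ) (p : (Fin N → S) →ₗ[S] M) (i : M →ₗ[S] Fin N → S), ∀ m, p (i m) = m := by
  obtain ⟨N, p, hp⟩ := Module.Finite.exists_fin' S M
  obtain ⟨i, hi⟩ := Module.projective_lifting_property p LinearMap.id hp
  exact ⟨N, p, i, LinearMap.congr_fun hi⟩

theorem comp_vecMul {m n : Type} [Fintype m] (v : m → T) (X : Matrix m n T) :
    φ ∘ Matrix.vecMul v X = Matrix.vecMul (φ ∘ v) (X.map φ) :=
  funext fun k => RingHom.map_vecMul φ X v k

theorem exists_finite_projective_isUniversalExtension {Ξ : Type} [AddCommGroup Ξ] [Module R Ξ]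
    (hfin : Module.Finite R Ξ) (hproj : Module.Projective R Ξ)
    (hidem : ∀ (N : ℕ) (e : Matrix (Fin N) (Fin N) R), e * e = e →
      ∃ f : Matrix (Fin N) (Fin N) T, f * f = f ∧
        ∃ u : (Matrix (Fin N) (Fin N) R)ˣ, f.map φ * u = u * e) :
    ∃ (M : Type) (_ : AddCommGroup M) (_ : Module T M), Module.Finite T M ∧
      Module.Projective T M ∧ ∃ j : M →ₛₗ[φ] Ξ, IsUniversalExtension j := by
  obtain ⟨N, π, ι, hπι⟩ := exists_split_of_finite_projective R Ξ hfin hproj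
  obtain ⟨e, he⟩ := Matrix.toLinearMapRight'.surjective (ι ∘ₗ π)
  have he' : ∀ w, Matrix.vecMul w e = ι (π w) := fun w => LinearMap.congr_fun he w
  have hee : e * e = e := by
    apply Matrix.toLinearMapRight'.injective
    refine LinearMap.ext fun w => ?_
    simp [he', hπι]
  obtain ⟨f, hff, u, hu⟩ := hidem N e hee
  let L := Matrix.toLinearMapRight' f
  have hL : ∀ v, L v = Matrix.vecMul v f := fun _ => rfl
  have hLL : ∀ m : LinearMap.range L, L.rangeRestrict m = m := by
    rintro ⟨_, v, rfl⟩
    ext1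
    simp [hL, hff]
  let P : (Fin N → R) →ₗ[R] Ξ := π ∘ₗ Matrix.toLinearMapRight' (u : Matrix (Fin N) (Fin N) R)
  let I : Ξ →ₗ[R] (Fin N → R) :=
    Matrix.toLinearMapRight' (↑u⁻¹ : Matrix (Fin N) (Fin N) R) ∘ₗ ι
  have hPI : ∀ ξ, P (I ξ) = ξ := fun ξ => by simp [P, I, hπι]
  have hIP : ∀ w, I (P w) = Matrix.vecMul w (f.map φ) := fun w => by
    simp [P, I, ← he', Matrix.vecMul_vecMul, mul_assoc]
    rw [← mul_assoc, ← hu, mul_assoc, Units.mul_inv, mul_one]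
  let j : LinearMap.range L →ₛₗ[φ] Ξ :=
    P.comp ((compSemilinear φ (Fin N)).comp (LinearMap.range L).subtype)
  refine ⟨LinearMap.range L, inferInstance, inferInstance,
    Module.Finite.of_surjective L.rangeRestrict L.surjective_rangeRestrict,
    Module.Projective.of_split (LinearMap.range L).subtype L.rangeRestrict
      (LinearMap.ext fun m => hLL m), j,
    isUniversalExtension_of_split j L.rangeRestrict (LinearMap.range L).subtype hLL P I hPI
      (fun v => ?_) fun m => ?_⟩
  · change P (φ ∘ v) = P (φ ∘ Matrix.vecMul v f)
    rw [comp_vecMul, ← hIP, hPI]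
  · change I (P (φ ∘ (m : Fin N → T))) = φ ∘ (m : Fin N → T)
    rw [hIP, ← comp_vecMul, ← hL]
    exact congrArg (fun x : LinearMap.range L => φ ∘ (x : Fin N → T)) (hLL m)

theorem bijective_of_retract {S M V : Type} [Ring S] [AddCommGroup M] [Module S M]
    [AddCommGroup V] [Module S V] (p : V →ₗ[S] M) (i : M →ₗ[S] V) (hpi : ∀ m, p (i m) = m)
    (h : M → M) (U : V → V) (hU : Function.Bijective U)
    (hUh : ∀ v, U v = i (h (p v)) + (v - i (p v))) : Function.Bijective h := by
  refine ⟨fun a b hab => ?_, fun m => ?_⟩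
  · have : U (i a) = U (i b) := by simp [hUh, hpi, hab]
    simpa [hpi] using congrArg p (hU.1 this)
  · obtain ⟨v, hv⟩ := hU.2 (i m)
    refine ⟨p v, ?_⟩
    simpa [hUh, hpi] using congrArg p hv

theorem bijective_vecMul_of_isUnit {m : Type} [Fintype m] [DecidableEq m] {U : Matrix m m T}
    (hU : IsUnit U) : Function.Bijective fun v => Matrix.vecMul v U := by
  obtain ⟨U, rfl⟩ := hU
  refine Function.bijective_iff_has_inverse.2
    ⟨fun v => Matrix.vecMul v (↑U⁻¹ : Matrix m m T), fun v => ?_, fun v => ?_⟩ <;> simp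

theorem denseRange_map_matrix [TopologicalSpace R] (hdense : DenseRange φ) (m n : Type) :
    DenseRange fun X : Matrix m n T => X.map φ :=
  DenseRange.piMap fun _ => DenseRange.piMap fun _ => hdense

/-- Two finitely generated projective modules over a dense, spectrally invariant subring are
isomorphic once they have a common base change. -/
theorem IsUniversalExtension.nonempty_linearEquiv [TopologicalSpace R] [IsTopologicalRing R]
    (hdense : DenseRange φ)
    (hopen : ∀ N : ℕ, IsOpen {U : Matrix (Fin N) (Fin N) R | IsUnit U})
    (hunit : ∀ (N : ℕ) (U : Matrix (Fin N) (Fin N) T), IsUnit (U.map φ) → IsUnit U)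
    {M₁ M₂ Ξ : Type} [AddCommGroup M₁] [Module T M₁] [AddCommGroup M₂] [Module T M₂]
    [AddCommGroup Ξ] [Module R Ξ]
    (hfin₁ : Module.Finite T M₁) (hproj₁ : Module.Projective T M₁)
    (hfin₂ : Module.Finite T M₂) (hproj₂ : Module.Projective T M₂)
    {j₁ : M₁ →ₛₗ[φ] Ξ} (hj₁ : IsUniversalExtension j₁)
    {j₂ : M₂ →ₛₗ[φ] Ξ} (hj₂ : IsUniversalExtension j₂) : Nonempty (M₁ ≃ₗ[T] M₂) := by
  obtain ⟨n₁, p₁, i₁, hpi₁⟩ := exists_split_of_finite_projective T M₁ hfin₁ hproj₁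
  obtain ⟨n₂, p₂, i₂, hpi₂⟩ := exists_split_of_finite_projective T M₂ hfin₂ hproj₂
  obtain ⟨P₁, I₁, hPI₁, hP₁, hI₁⟩ := hj₁.exists_split p₁ i₁ hpi₁
  obtain ⟨P₂, I₂, hPI₂, hP₂, hI₂⟩ := hj₂.exists_split p₂ i₂ hpi₂
  obtain ⟨E₁, hE₁⟩ := Matrix.toLinearMapRight'.surjective (i₁ ∘ₗ p₁)
  obtain ⟨E₂, hE₂⟩ := Matrix.toLinearMapRight'.surjective (i₂ ∘ₗ p₂)
  obtain ⟨x, hx⟩ := Matrix.toLinearMapRight'.surjective (I₂ ∘ₗ P₁)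
  obtain ⟨y, hy⟩ := Matrix.toLinearMapRight'.surjective (I₁ ∘ₗ P₂)
  replace hE₁ : ∀ v, Matrix.vecMul v E₁ = i₁ (p₁ v) := fun v => LinearMap.congr_fun hE₁ v
  replace hE₂ : ∀ v, Matrix.vecMul v E₂ = i₂ (p₂ v) := fun v => LinearMap.congr_fun hE₂ v
  replace hx : ∀ v, Matrix.vecMul v x = I₂ (P₁ v) := fun v => LinearMap.congr_fun hx v
  replace hy : ∀ v, Matrix.vecMul v y = I₁ (P₂ v) := fun v => LinearMap.congr_fun hy v
  have hφE₁ : ∀ w, Matrix.vecMul w (E₁.map φ) = I₁ (P₁ w) := LinearMap.congr_fun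
    (linearMap_ext_of_comp (φ := φ) (f := Matrix.toLinearMapRight' (E₁.map φ)) (g := I₁ ∘ₗ P₁)
      fun v => by simp [← comp_vecMul, hE₁, hP₁, hI₁])
  have hφE₂ : ∀ w, Matrix.vecMul w (E₂.map φ) = I₂ (P₂ w) := LinearMap.congr_fun
    (linearMap_ext_of_comp (φ := φ) (f := Matrix.toLinearMapRight' (E₂.map φ)) (g := I₂ ∘ₗ P₂)
      fun v => by simp [← comp_vecMul, hE₂, hP₂, hI₂])
  have hxy₁ : E₁.map φ * x * E₂.map φ * y * E₁.map φ + (1 - E₁.map φ) = 1 := by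
    apply Matrix.toLinearMapRight'.injective
    refine LinearMap.ext fun w => ?_
    simp [hφE₁, hφE₂, hx, hy, hPI₁, hPI₂]
  have hxy₂ : E₂.map φ * y * E₁.map φ * x * E₂.map φ + (1 - E₂.map φ) = 1 := by
    apply Matrix.toLinearMapRight'.injective
    refine LinearMap.ext fun w => ?_
    simp [hφE₁, hφE₂, hx, hy, hPI₁, hPI₂]
  let O : Set (Matrix (Fin n₁) (Fin n₂) R × Matrix (Fin n₂) (Fin n₁) R) :=
    {q | IsUnit (E₁.map φ * q.1 * E₂.map φ * q.2 * E₁.map φ + (1 - E₁.map φ)) ∧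
      IsUnit (E₂.map φ * q.2 * E₁.map φ * q.1 * E₂.map φ + (1 - E₂.map φ))}
  have hO : IsOpen O := by
    refine IsOpen.inter ((hopen n₁).preimage ?_) ((hopen n₂).preimage ?_) <;> fun_prop
  obtain ⟨⟨X, Y⟩, hX, hY⟩ := ((denseRange_map_matrix hdense _ _).prodMap
    (denseRange_map_matrix hdense _ _)).exists_mem_open hO
    ⟨(x, y), by simp [O, hxy₁, hxy₂]⟩
  have hU₁ : IsUnit (E₁ * X * E₂ * Y * E₁ + (1 - E₁)) := hunit n₁ _ (by
    convert hX using 1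
    simp [Matrix.map_mul, Matrix.map_add φ (map_add φ), Matrix.map_sub φ (map_sub φ)])
  have hU₂ : IsUnit (E₂ * Y * E₁ * X * E₂ + (1 - E₂)) := hunit n₂ _ (by
    convert hY using 1
    simp [Matrix.map_mul, Matrix.map_add φ (map_add φ), Matrix.map_sub φ (map_sub φ)])
  let f : M₁ →ₗ[T] M₂ := p₂ ∘ₗ Matrix.toLinearMapRight' X ∘ₗ i₁
  let g : M₂ →ₗ[T] M₁ := p₁ ∘ₗ Matrix.toLinearMapRight' Y ∘ₗ i₂
  have hgf : Function.Bijective (g ∘ f) :=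
    bijective_of_retract p₁ i₁ hpi₁ _ _ (bijective_vecMul_of_isUnit hU₁) fun v => by
      simp [f, g, Matrix.vecMul_add, Matrix.vecMul_sub, ← Matrix.vecMul_vecMul, hE₁, hE₂]
  have hfg : Function.Bijective (f ∘ g) :=
    bijective_of_retract p₂ i₂ hpi₂ _ _ (bijective_vecMul_of_isUnit hU₂) fun v => by
      simp [f, g, Matrix.vecMul_add, Matrix.vecMul_sub, ← Matrix.vecMul_vecMul, hE₁, hE₂]
  exact ⟨LinearEquiv.ofBijective f ⟨hgf.1.of_comp, hfg.2.of_comp⟩⟩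

end BaseChange

section SquareRoot

open Filter Topology

variable {B : Type} [NormedRing B]

theorem eq_zero_of_mul_add_mul_eq_zero [NormedAlgebra ℝ B] {u v d : B} (hu : ‖u - 1‖ < 1)
    (hv : ‖v - 1‖ < 1) (h : u * d + d * v = 0) : d = 0 := by
  have h2 : (2 : ℝ) • d = -((u - 1) * d + d * (v - 1)) := by
    rw [two_smul, ← sub_eq_zero, ← h]; noncomm_ring
  have h3 : 2 * ‖d‖ ≤ ‖u - 1‖ * ‖d‖ + ‖d‖ * ‖v - 1‖ := by
    calc 2 * ‖d‖ = ‖(2 : ℝ) • d‖ := by rw [norm_smul]; simp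
      _ = ‖(u - 1) * d + d * (v - 1)‖ := by rw [h2, norm_neg]
      _ ≤ _ := (norm_add_le _ _).trans (add_le_add (norm_mul_le _ _) (norm_mul_le _ _))
  have := norm_nonneg d
  exact norm_eq_zero.1 (by nlinarith)

theorem eq_of_mul_self_eq_mul_self_of_norm_sub_one_lt [NormedAlgebra ℝ B] {s t : B}
    (hs : ‖s - 1‖ < 1) (ht : ‖t - 1‖ < 1) (h : s * s = t * t) : s = t :=
  sub_eq_zero.1 <| eq_zero_of_mul_add_mul_eq_zero hs ht <| by
    rw [mul_sub, sub_mul, h]; abel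

theorem commute_of_commute_mul_self [NormedAlgebra ℝ B] {s c : B} (hs : ‖s - 1‖ < 1)
    (h : Commute c (s * s)) : Commute c s :=
  sub_eq_zero.1 <| eq_zero_of_mul_add_mul_eq_zero hs hs <| by
    have := h.eq
    rw [mul_sub, sub_mul, mul_assoc c s s, this]; noncomm_ring

/-- The inverse function theorem gives a smooth square root near `1` in a Banach algebra. -/
theorem exists_contDiffAt_sqrt [NormedAlgebra ℝ B] [CompleteSpace B] :
    ∃ Φ : B → B, Φ 1 = 1 ∧ ContinuousAt Φ 1 ∧
      ∀ᶠ x in 𝓝 1, ContDiffAt ℝ (⊤ : ℕ∞) Φ x ∧ Φ x * Φ x = x ∧ ‖Φ x - 1‖ < 1 := by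
  let f' : B ≃L[ℝ] B := ContinuousLinearEquiv.smulLeft (Units.mk0 (2 : ℝ) two_ne_zero)
  have hsm : ContDiffAt ℝ (⊤ : WithTop ℕ∞) (fun y : B => y * y) 1 :=
    contDiffAt_id.mul contDiffAt_id
  have hf : HasStrictFDerivAt (fun y : B => y * y) (f' : B →L[ℝ] B) 1 := by
    have := (hasStrictFDerivAt_id (𝕜 := ℝ) (1 : B)).mul' (hasStrictFDerivAt_id (1 : B))
    refine this.congr_fderiv (ContinuousLinearMap.ext fun y => ?_)
    simp [f', two_smul, Units.smul_def]
  let Φ := hf.localInverse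
  have h1 : Φ 1 = 1 := by simpa using hf.localInverse_apply_image
  have hc : ContinuousAt Φ 1 := by simpa using hf.localInverse_continuousAt
  have hs : ContDiffAt ℝ (⊤ : WithTop ℕ∞) Φ 1 := by
    have := hsm.to_localInverse hf.hasFDerivAt (by simp)
    rwa [mul_one] at this
  have hr : ∀ᶠ x in 𝓝 1, Φ x * Φ x = x := by simpa using hf.eventually_right_inverse
  have hlt : ∀ᶠ x in 𝓝 1, ‖Φ x - 1‖ < 1 := by
    have := hc.eventually (Metric.ball_mem_nhds (Φ 1) one_pos)
    simpa [h1, dist_eq_norm] using this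
  refine ⟨Φ, h1, hc, ?_⟩
  filter_upwards [hs.eventually (by simp), hr, hlt]
    with x hx1 hx2 hx3
  exact ⟨hx1.of_le le_top, hx2, hx3⟩

end SquareRoot

section SmoothVectors

open Filter Topology

variable {V B : Type} [NormedAddCommGroup V] [NormedSpace ℝ V] [NormedRing B] [NormedAlgebra ℝ B]

theorem contDiff_ringInverse_orbit [CompleteSpace B] (β : V → B →+* B) {b : B}
    (hb : ContDiff ℝ (⊤ : ℕ∞) fun g => β g b) (hu : IsUnit b) :
    ContDiff ℝ (⊤ : ℕ∞) fun g => β g (Ring.inverse b) := by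
  have h : (fun g => β g (Ring.inverse b)) = fun g => Ring.inverse (β g b) := by
    ext g
    obtain ⟨u, rfl⟩ := hu
    have : β g u = Units.map (β g : B →* B) u := rfl
    rw [this, Ring.inverse_unit, Ring.inverse_unit, ← map_inv]
    rfl
  rw [h, contDiff_iff_contDiffAt]
  intro g
  obtain ⟨v, hv⟩ := hu.map (β g)
  have hi := contDiffAt_ringInverse ℝ (n := (⊤ : ℕ∞)) v
  rw [hv] at hi
  exact hi.comp g hb.contDiffAt

/-- Every idempotent of a Banach algebra with an isometric action is similar to a smooth one,
provided smooth elements are dense. -/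
theorem exists_smooth_idempotent [CompleteSpace B] (β : V → B →+* B)
    (hβ : ∀ g b, ‖β g b‖ = ‖b‖)
    (hdense : Dense {b : B | ContDiff ℝ (⊤ : ℕ∞) fun g => β g b}) {e : B} (he : e * e = e) :
    ∃ f : B, f * f = f ∧ (ContDiff ℝ (⊤ : ℕ∞) fun g => β g f) ∧
      ∃ u : Bˣ, f * u = u * e := by
  obtain ⟨Φ, hΦ1, hΦc, hΦ⟩ := exists_contDiffAt_sqrt (B := B)
  obtain ⟨δ, hδ, hball⟩ := Metric.eventually_nhds_iff.1 hΦ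
  set c₀ : B := 2 * e - 1 with hc₀
  have hc₀sq : c₀ * c₀ = 1 := by
    have : c₀ * c₀ = 4 * (e * e) - 4 * e + 1 := by rw [hc₀]; noncomm_ring
    rw [this, he]; simp
  have hsq : Tendsto (fun c : B => c * c) (𝓝 c₀) (𝓝 1) := by
    rw [← hc₀sq]; exact (continuous_id.mul continuous_id).tendsto c₀
  have hΦsq : Tendsto (fun c : B => Φ (c * c)) (𝓝 c₀) (𝓝 1) := by
    have := hΦc.tendsto.comp hsq
    rwa [hΦ1] at this
  have hinv : Tendsto (fun c : B => Ring.inverse (Φ (c * c))) (𝓝 c₀) (𝓝 1) := by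
    have := (NormedRing.inverse_continuousAt (1 : Bˣ)).tendsto
    simp only [Units.val_one, Ring.inverse_one] at this
    exact this.comp hΦsq
  let F : B → B := fun c => (2⁻¹ : ℝ) • (1 + c * Ring.inverse (Φ (c * c)))
  have hF : Tendsto F (𝓝 c₀) (𝓝 e) := by
    have h := ((tendsto_const_nhds (x := (1 : B))).add (tendsto_id.mul hinv)).const_smul (2⁻¹ : ℝ)
    have h' : (2⁻¹ : ℝ) • (1 + c₀ * 1) = e := by
      rw [hc₀, mul_one, add_sub_cancel, two_mul, ← two_smul ℝ e, smul_smul]; simp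
    rwa [h'] at h
  have hU : Tendsto (fun c => F c * e + (1 - F c) * (1 - e)) (𝓝 c₀) (𝓝 1) := by
    have h := (hF.mul_const e).add ((tendsto_const_nhds (x := (1 : B)).sub hF).mul_const (1 - e))
    have h' : e * e + (1 - e) * (1 - e) = 1 := by
      rw [mul_sub, sub_mul, sub_mul, he]; simp
    rwa [h'] at h
  have hopen : ∀ᶠ b in 𝓝 (1 : B), IsUnit b := Units.isOpen.mem_nhds isUnit_one
  obtain ⟨c, hc, hunit, hsunit, hcδ⟩ :=
    (mem_closure_iff_frequently.1 (hdense c₀)).and_eventually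
    ((hU.eventually hopen).and ((hΦsq.eventually hopen).and
      (hsq.eventually (Metric.ball_mem_nhds 1 hδ)))) |>.exists
  replace hc : ContDiff ℝ (⊤ : ℕ∞) fun g => β g c := hc
  set s := Φ (c * c) with hs
  obtain ⟨-, hss, hs1⟩ := hball hcδ
  have hscomm : Commute c s := commute_of_commute_mul_self hs1 (by
    rw [hss]; exact (Commute.refl c).mul_right (Commute.refl c))
  have hβs : ∀ g, β g s = Φ (β g (c * c)) ∧ ContDiffAt ℝ (⊤ : ℕ∞) Φ (β g (c * c)) := fun g => by
    have hn : ∀ b, ‖β g b - 1‖ = ‖b - 1‖ := fun b => by rw [← hβ g (b - 1), map_sub, map_one]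
    obtain ⟨h1, h2, h3⟩ := hball (y := β g (c * c)) (by
      rw [dist_eq_norm, hn, ← dist_eq_norm]; exact hcδ)
    refine ⟨eq_of_mul_self_eq_mul_self_of_norm_sub_one_lt (by rwa [hn]) h3 ?_, h1⟩
    rw [h2, ← map_mul, hss]
  have hcc : ContDiff ℝ (⊤ : ℕ∞) fun g => β g (c * c) := by
    simp only [map_mul]; exact hc.mul hc
  have hssm : ContDiff ℝ (⊤ : ℕ∞) fun g => β g s := by
    rw [funext fun g => (hβs g).1, contDiff_iff_contDiffAt]
    exact fun g => (hβs g).2.comp g hcc.contDiffAt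
  set t := Ring.inverse s with ht
  have htsm : ContDiff ℝ (⊤ : ℕ∞) fun g => β g t := contDiff_ringInverse_orbit β hssm hsunit
  have hst : s * t = 1 := Ring.mul_inverse_cancel s hsunit
  have hts : t * s = 1 := Ring.inverse_mul_cancel s hsunit
  have hct : (c * t) * (c * t) = 1 := by
    have htc : t * c = c * t := by
      calc t * c = t * c * (s * t) := by rw [hst, mul_one]
        _ = t * (c * s) * t := by noncomm_ring
        _ = (t * s) * c * t := by rw [hscomm.eq]; noncomm_ring
        _ = c * t := by rw [hts, one_mul]
    calc (c * t) * (c * t) = c * (t * c) * t := by noncomm_ring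
      _ = (c * c) * (t * t) := by rw [htc]; noncomm_ring
      _ = s * (s * t) * t := by rw [← hss]; noncomm_ring
      _ = 1 := by rw [hst, mul_one, hst]
  have hFc : F c = (2⁻¹ : ℝ) • (1 + c * t) := rfl
  have hFF : F c * F c = F c := by
    rw [hFc, smul_mul_smul_comm, mul_add, mul_one, add_mul, one_mul, hct]
    rw [show 1 + c * t + (c * t + 1) = (2 : ℝ) • (1 + c * t) by
      rw [two_smul]; abel, smul_smul]
    norm_num
  refine ⟨F c, hFF, ?_, hunit.unit, ?_⟩
  · have : (fun g => β g (F c)) = fun g => (2⁻¹ : ℝ) • (1 + β g c * β g t) := by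
      ext g
      rw [hFc, map_real_smul (β g) (AddMonoidHomClass.isometry_of_norm (β g) (hβ g)).continuous]
      simp
    rw [this]
    exact (contDiff_const.add (hc.mul htsm)).const_smul _
  · have h1 : F c * (1 - F c) = 0 := by rw [mul_sub, hFF, mul_one, sub_self]
    have h2 : (1 - e) * e = 0 := by rw [sub_mul, he, one_mul, sub_self]
    rw [IsUnit.unit_spec, mul_add, add_mul, ← mul_assoc, ← mul_assoc, hFF, h1, mul_assoc _ e, he,
      mul_assoc _ (1 - e), h2]
    simp

end SmoothVectors

section Garding

open Filter Topology MeasureTheory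

/-- Smooth vectors of a jointly continuous action of `V` on a Banach space are dense. -/
theorem dense_contDiff_orbit {V E : Type} [NormedAddCommGroup V] [NormedSpace ℝ V]
    [FiniteDimensional ℝ V] [NormedAddCommGroup E] [NormedSpace ℝ E] [CompleteSpace E]
    (α : V → E →L[ℝ] E) (hα₀ : ∀ x, α 0 x = x) (hα_add : ∀ g h x, α (g + h) x = α g (α h x))
    (hcont : ∀ x, Continuous fun g => α g x) :
    Dense {x : E | ContDiff ℝ (⊤ : ℕ∞) fun g => α g x} := by
  let _ : MeasurableSpace V := borel V
  have _ : BorelSpace V := ⟨rfl⟩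
  let μ : Measure V := Measure.addHaar
  intro x
  let ψ : ℕ → ContDiffBump (0 : V) := fun k =>
    { rIn := 1 / (k + 1 : ℝ) / 2
      rOut := 1 / (k + 1 : ℝ)
      rIn_pos := by positivity
      rIn_lt_rOut := half_lt_self (by positivity) }
  let y : ℕ → V → E := fun k =>
    convolution ((ψ k).normed μ) (fun g => α g x) (ContinuousLinearMap.lsmul ℝ ℝ) μ
  have hlim : Tendsto (fun k => y k 0) atTop (𝓝 x) := by
    simpa [hα₀] using ContDiffBump.convolution_tendsto_right_of_continuous (μ := μ) (φ := ψ)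
      tendsto_one_div_add_atTop_nhds_zero_nat (hcont x) 0
  refine mem_closure_of_tendsto hlim (Eventually.of_forall fun k => ?_)
  have hy : (fun g => α g (y k 0)) = y k := by
    ext g
    have hint : Integrable (fun t => (ψ k).normed μ t • α (0 - t) x) μ :=
      (((ψ k).continuous_normed).smul ((hcont x).comp (continuous_const.sub continuous_id)))
        |>.integrable_of_hasCompactSupport ((ψ k).hasCompactSupport_normed.smul_right)
    simp only [y, convolution_def, ContinuousLinearMap.lsmul_apply]
    rw [← (α g).integral_comp_comm hint]
    simp [← hα_add, sub_eq_add_neg]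
  change ContDiff ℝ (⊤ : ℕ∞) fun g => α g (y k 0)
  rw [hy]
  exact (ψ k).hasCompactSupport_normed.contDiff_convolution_left _ (ψ k).contDiff_normed
    (hcont x).locallyIntegrable

end Garding

section MatrixNorm

open scoped Matrix.Norms.Operator

variable {m R : Type} [Fintype m] [DecidableEq m] [NormedRing R]

theorem completeSpace_matrix_linftyOp [CompleteSpace R] :
    @CompleteSpace (Matrix m m R)
      (Matrix.linftyOpNormedRing.toMetricSpace.toPseudoMetricSpace.toUniformSpace) :=
  inferInstanceAs (CompleteSpace (m → m → R))

theorem isOpen_isUnit_matrix [CompleteSpace R] : IsOpen {U : Matrix m m R | IsUnit U} := by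
  have := completeSpace_matrix_linftyOp (m := m) (R := R)
  exact Units.isOpen

theorem norm_map_matrix {γ : R → R} (hγ : ∀ r, ‖γ r‖ = ‖r‖) (U : Matrix m m R) :
    ‖U.map γ‖ = ‖U‖ := by
  have hγ' : ∀ r, ‖γ r‖₊ = ‖r‖₊ := fun r => NNReal.eq (hγ r)
  simp [Matrix.linfty_opNorm_def, hγ']

theorem contDiff_matrix_iff [NormedAlgebra ℝ R] {V : Type} [NormedAddCommGroup V]
    [NormedSpace ℝ V] {f : V → Matrix m m R} :
    ContDiff ℝ (⊤ : ℕ∞) f ↔ ∀ i j, ContDiff ℝ (⊤ : ℕ∞) fun g => f g i j := by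
  refine ⟨fun h i j => ?_, fun h => ?_⟩
  · let L : Matrix m m R →L[ℝ] R :=
      ⟨Matrix.entryLinearMap ℝ R i j, continuous_id.matrix_elem i j⟩
    exact L.contDiff.comp h
  · let L : m → m → R →L[ℝ] Matrix m m R := fun i j =>
      ⟨Matrix.singleLinearMap ℝ i j, continuous_matrix fun a b => by
        by_cases hab : i = a ∧ j = b <;> simp [hab] <;> fun_prop⟩
    have hf : f = fun g => ∑ i, ∑ j, L i j (f g i j) := by
      ext1 g
      exact Matrix.matrix_eq_sum_single (f g)
    rw [hf]
    exact ContDiff.sum fun i _ => ContDiff.sum fun j _ => (L i j).contDiff.comp (h i j)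

end MatrixNorm

section SmoothMatrices

open scoped Matrix.Norms.Operator

variable {V R T : Type} [NormedAddCommGroup V] [NormedSpace ℝ V] [NormedRing R] [NormedAlgebra ℝ R]
  [Ring T] {φ : T →+* R} {γ : V → R →+* R}

theorem exists_map_eq_iff_contDiff_orbit {m : Type} [Fintype m] [DecidableEq m]
    (hφ : ∀ r, r ∈ Set.range φ ↔ ContDiff ℝ (⊤ : ℕ∞) fun g => γ g r) (U : Matrix m m R) :
    (∃ U' : Matrix m m T, U'.map φ = U) ↔
      ContDiff ℝ (⊤ : ℕ∞) fun g => (γ g).mapMatrix U := by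
  rw [contDiff_matrix_iff]
  refine ⟨?_, fun h => ?_⟩
  · rintro ⟨U', rfl⟩ i j
    exact (hφ _).1 ⟨U' i j, rfl⟩
  · choose U' hU' using fun i j => (hφ (U i j)).2 (h i j)
    exact ⟨U', Matrix.ext hU'⟩

theorem isUnit_of_isUnit_map_matrix [CompleteSpace R] {m : Type} [Fintype m] [DecidableEq m]
    (hinj : Function.Injective φ)
    (hφ : ∀ r, r ∈ Set.range φ ↔ ContDiff ℝ (⊤ : ℕ∞) fun g => γ g r)
    (U : Matrix m m T) (hU : IsUnit (U.map φ)) : IsUnit U := by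
  have := completeSpace_matrix_linftyOp (m := m) (R := R)
  have hsm := contDiff_ringInverse_orbit (fun g => (γ g).mapMatrix)
    ((exists_map_eq_iff_contDiff_orbit hφ _).1 ⟨U, rfl⟩) hU
  obtain ⟨W, hW⟩ := (exists_map_eq_iff_contDiff_orbit hφ _).2 hsm
  have hone : (1 : Matrix m m T).map φ = 1 := map_one φ.mapMatrix
  refine ⟨⟨U, W, Matrix.map_injective hinj ?_, Matrix.map_injective hinj ?_⟩, rfl⟩
  · simp only [Matrix.map_mul, hW, hone, Ring.mul_inverse_cancel _ hU]
  · simp only [Matrix.map_mul, hW, hone, Ring.inverse_mul_cancel _ hU]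

theorem dense_contDiff_orbit_matrix {m : Type} [Fintype m] [DecidableEq m]
    (hdense : DenseRange φ)
    (hφ : ∀ r, r ∈ Set.range φ ↔ ContDiff ℝ (⊤ : ℕ∞) fun g => γ g r) :
    Dense {U : Matrix m m R | ContDiff ℝ (⊤ : ℕ∞) fun g => (γ g).mapMatrix U} := by
  refine Dense.mono ?_ (denseRange_map_matrix hdense m m)
  intro U hU
  exact (exists_map_eq_iff_contDiff_orbit hφ U).1 hU

theorem exists_idempotent_matrix_similar [CompleteSpace R] {m : Type} [Fintype m] [DecidableEq m]
    (hinj : Function.Injective φ) (hdense : DenseRange φ)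
    (hφ : ∀ r, r ∈ Set.range φ ↔ ContDiff ℝ (⊤ : ℕ∞) fun g => γ g r)
    (hγ : ∀ g r, ‖γ g r‖ = ‖r‖) (e : Matrix m m R) (he : e * e = e) :
    ∃ f : Matrix m m T, f * f = f ∧ ∃ u : (Matrix m m R)ˣ, f.map φ * u = u * e := by
  have := completeSpace_matrix_linftyOp (m := m) (R := R)
  have hnorm : ∀ g (U : Matrix m m R), ‖(γ g).mapMatrix U‖ = ‖U‖ :=
    fun g => norm_map_matrix (hγ g)
  have hsmooth := exists_smooth_idempotent (B := Matrix m m R) (fun g => (γ g).mapMatrix) hnorm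
    (dense_contDiff_orbit_matrix hdense hφ) he
  obtain ⟨f', hf', hsm, u, hu⟩ := hsmooth
  obtain ⟨f, hf⟩ := (exists_map_eq_iff_contDiff_orbit hφ f').2 hsm
  refine ⟨f, Matrix.map_injective hinj ?_, u, ?_⟩
  · simpa only [Matrix.map_mul, hf] using hf'
  · rw [hf]
    exact hu

end SmoothMatrices

section SmoothModels

variable {A : Type} [NormedRing A] [NormedAlgebra ℂ A] {S : Subring A}

theorem smoothBaseChange_iff {M Ξ : Type} [AddCommGroup M] [Module Sᵐᵒᵖ M] [AddCommGroup Ξ]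
    [Module Aᵐᵒᵖ Ξ] :
    SmoothBaseChange S M Ξ ↔
      ∃ j : M →ₛₗ[RingHom.op S.subtype] Ξ, IsUniversalExtension j := by
  constructor
  · rintro ⟨j, hj, huniv⟩
    exact ⟨{ j with map_smul' := fun c m => hj c.unop m }, fun N _ _ f =>
      huniv N f.toAddMonoidHom fun s m => f.map_smul' (MulOpposite.op s) m⟩
  · rintro ⟨j, huniv⟩
    exact ⟨j.toAddMonoidHom, fun s m => j.map_smul' (MulOpposite.op s) m, fun N _ _ f hf =>
      huniv N { f with map_smul' := fun c m => hf c.unop m }⟩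

end SmoothModels

section SmoothSubring

variable {A : Type} [NormedRing A] [StarRing A] [NormedAlgebra ℂ A] {n : ℕ}
  {α : (Fin n → ℝ) → (A ≃⋆ₐ[ℂ] A)}

theorem norm_starAlgEquiv_apply [CStarRing A] [CompleteSpace A] [StarModule ℂ A]
    (σ : A ≃⋆ₐ[ℂ] A) (x : A) : ‖σ x‖ = ‖x‖ :=
  let _ : CStarAlgebra A := { }
  NonUnitalStarAlgHom.norm_map σ σ.injective x

theorem mem_range_op_subtype_iff (r : Aᵐᵒᵖ) :
    r ∈ Set.range (RingHom.op (smoothSubring n α).subtype) ↔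
      ContDiff ℝ (⊤ : ℕ∞) fun g => RingHom.op (α g : A →+* A) r := by
  let L := (MulOpposite.opContinuousLinearEquiv ℝ : A ≃L[ℝ] Aᵐᵒᵖ)
  have h : r ∈ Set.range (RingHom.op (smoothSubring n α).subtype) ↔
      r.unop ∈ smoothSubring n α :=
    ⟨by rintro ⟨t, rfl⟩; exact t.unop.2, fun hr => ⟨MulOpposite.op ⟨r.unop, hr⟩, rfl⟩⟩
  rw [h]
  exact (L.comp_contDiff_iff (n := (⊤ : ℕ∞)) (f := fun g => α g r.unop)).symm

theorem denseRange_op_subtype [CStarRing A] [CompleteSpace A] [StarModule ℂ A]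
    (hα₀ : ∀ x : A, α 0 x = x)
    (hα_add : ∀ (g h : Fin n → ℝ) (x : A), α (g + h) x = α g (α h x))
    (hcont : Continuous fun p : (Fin n → ℝ) × A => α p.1 p.2) :
    DenseRange (RingHom.op (smoothSubring n α).subtype) := by
  let α' : (Fin n → ℝ) → A →L[ℝ] A := fun g =>
    ⟨((α g : A →ₐ[ℂ] A).toLinearMap.restrictScalars ℝ),
      hcont.comp (continuous_const.prodMk continuous_id)⟩
  have hd : Dense (smoothSubring n α : Set A) := dense_contDiff_orbit α' hα₀ hα_add fun x =>
    hcont.comp (continuous_id.prodMk continuous_const)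
  have hop : DenseRange (MulOpposite.op ∘ (Subtype.val : smoothSubring n α → A)) :=
    MulOpposite.op_surjective.denseRange.comp hd.denseRange_val MulOpposite.continuous_op
  exact (hop.mono (by rintro _ ⟨s, rfl⟩; exact ⟨MulOpposite.op s, rfl⟩))

end SmoothSubring

/-- Lemma 1: for every finitely generated projective right `A`-module `Ξ`
there is a finitely generated projective right `A^∞`-module `Ξ^∞`, unique up to
isomorphism, with `Ξ ≅ Ξ^∞ ⊗_{A^∞} A`. -/
theorem exists_unique_smooth_model
    {A : Type} [NormedRing A] [StarRing A] [CStarRing A]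
    [NormedAlgebra ℂ A] [CompleteSpace A] [StarModule ℂ A]
    (n : ℕ) (α : (Fin n → ℝ) → (A ≃⋆ₐ[ℂ] A))
    (hα₀ : ∀ x : A, α 0 x = x)
    (hα_add : ∀ (g h : Fin n → ℝ) (x : A), α (g + h) x = α g (α h x))
    (hcont : Continuous fun p : (Fin n → ℝ) × A => α p.1 p.2)
    (Ξ : Type) [AddCommGroup Ξ] [Module Aᵐᵒᵖ Ξ]
    (hfin : Module.Finite Aᵐᵒᵖ Ξ) (hproj : Module.Projective Aᵐᵒᵖ Ξ) :
    (∃ M : Type, Nonempty (SmoothModel (smoothSubring n α) Ξ M)) ∧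
    (∀ (M₁ M₂ : Type) (h₁ : SmoothModel (smoothSubring n α) Ξ M₁)
        (h₂ : SmoothModel (smoothSubring n α) Ξ M₂),
      Nonempty
        (letI := h₁.addCommGroup; letI := h₁.module
         letI := h₂.addCommGroup; letI := h₂.module
         M₁ ≃ₗ[(smoothSubring n α)ᵐᵒᵖ] M₂)) := by
  have hd := denseRange_op_subtype hα₀ hα_add hcont
  have hr := mem_range_op_subtype_iff (α := α)
  have hinj : Function.Injective (RingHom.op (smoothSubring n α).subtype) := fun a b hab =>
    MulOpposite.unop_injective (Subtype.ext (congrArg MulOpposite.unop hab))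
  have hγ : ∀ g (r : Aᵐᵒᵖ), ‖RingHom.op (α g : A →+* A) r‖ = ‖r‖ := fun g r =>
    norm_starAlgEquiv_apply (α g) r.unop
  refine ⟨?_, fun M₁ M₂ h₁ h₂ => ?_⟩
  · obtain ⟨M, _, _, hM, hM', hj⟩ := exists_finite_projective_isUniversalExtension hfin hproj
      fun N => exists_idempotent_matrix_similar (m := Fin N) hinj hd hr hγ
    exact ⟨M, ⟨⟨hM, hM', smoothBaseChange_iff.2 hj⟩⟩⟩
  · let _ := h₁.addCommGroup
    let _ := h₁.module
    let _ := h₂.addCommGroup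
    let _ := h₂.module
    obtain ⟨j₁, hj₁⟩ := smoothBaseChange_iff.1 h₁.baseChange
    obtain ⟨j₂, hj₂⟩ := smoothBaseChange_iff.1 h₂.baseChange
    exact hj₁.nonempty_linearEquiv hd (fun N => isOpen_isUnit_matrix)
      (fun N => isUnit_of_isUnit_map_matrix hinj hr) h₁.finite h₁.projective h₂.finite
      h₂.projective hj₂
end

section
/- The first Chern number c_1 is invariant under differentiable homotopies of idempotents: if t ↦ e(t) is a continuously differentiable map from [0,1] to A with e(t)² = e(t) for every t ∈ [0,1], then the function t ↦ c_1(e(t)) is constant on [0,1]; in particular c_1(e(0)) = c_1(e(1)). -/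
/-- The first Chern number `c₁(x) = (1/2πi) τ(x(δ₁(x)δ₂(x) - δ₂(x)δ₁(x)))`. -/
noncomputable def chernOne {A : Type} [NormedRing A] [NormedAlgebra ℂ A]
    (δ₁ δ₂ : A →L[ℂ] A) (τ : A →L[ℂ] ℂ) (x : A) : ℂ :=
  (1 / (2 * (Real.pi : ℂ) * Complex.I)) * τ (x * (δ₁ x * δ₂ x - δ₂ x * δ₁ x))

section Trace

variable {A : Type} [NormedRing A] [NormedAlgebra ℂ A]

/-- If `a` and `b` satisfy the Leibniz relation of a derivative of the idempotent `e`, then `a * b`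
commutes with `e`. -/
theorem commute_mul_of_eq_mul_add_mul {R : Type*} [Ring R] {e a b : R}
    (ha : a = a * e + e * a) (hb : b = b * e + e * b) : Commute e (a * b) := by
  have ha' : e * a = a - a * e := eq_sub_of_add_eq' ha.symm
  have hb' : b - e * b = b * e := sub_eq_of_eq_add hb
  calc e * (a * b) = (a - a * e) * b := by rw [← mul_assoc, ha']
    _ = a * (b - e * b) := by noncomm_ring
    _ = a * b * e := by rw [hb', mul_assoc]

/-- A trace vanishes on products of an off-diagonal element and a diagonal element with respect to
an idempotent. -/
theorem trace_mul_eq_zero_of_commute {τ : A →L[ℂ] ℂ} (htr : ∀ a b : A, τ (a * b) = τ (b * a))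
    {e g c : A} (he : e * e = e) (hg : g = g * e + e * g) (hc : Commute e c) :
    τ (g * c) = 0 := by
  have hege : e * g * e = 0 := by
    have h : e * g = e * g * e + e * g := by
      calc e * g = e * (g * e + e * g) := by rw [← hg]
        _ = e * g * e + e * e * g := by noncomm_ring
        _ = e * g * e + e * g := by rw [he]
    exact right_eq_add.mp h
  have h₁ : τ (g * e * c) = 0 := by
    calc τ (g * e * c) = τ (g * (e * e) * c) := by rw [he]
      _ = τ (g * e * (e * c)) := by simp only [mul_assoc]
      _ = τ (g * e * c * e) := by rw [hc.eq, mul_assoc (g * e)]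
      _ = τ (e * (g * e * c)) := htr _ _
      _ = τ (e * g * e * c) := by simp only [mul_assoc]
      _ = 0 := by rw [hege, zero_mul, map_zero]
  have h₂ : τ (e * g * c) = 0 := by
    calc τ (e * g * c) = τ (e * e * g * c) := by rw [he]
      _ = τ (e * (e * g * c)) := by simp only [mul_assoc]
      _ = τ (e * g * c * e) := htr _ _
      _ = τ (e * g * e * c) := by rw [mul_assoc, ← hc.eq, ← mul_assoc]
      _ = 0 := by rw [hege, zero_mul, map_zero]
  rw [hg, add_mul, map_add, h₁, h₂, add_zero]

/-- Integration by parts for a trace that vanishes on the range of a derivation. -/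
theorem trace_derivation_mul {δ : A →L[ℂ] A}
    (hδ : ∀ x y : A, δ (x * y) = δ x * y + x * δ y)
    {τ : A →L[ℂ] ℂ} (hτδ : ∀ a : A, τ (δ a) = 0) (x y : A) :
    τ (δ x * y) = -τ (x * δ y) := by
  rw [eq_neg_iff_add_eq_zero, ← map_add, ← hδ, hτδ]

/-- The first variation of `c₁` at an idempotent `e` vanishes in every direction `g` tangent to the
idempotents. -/
theorem trace_variation_eq_zero {δ₁ δ₂ : A →L[ℂ] A}
    (hδ₁ : ∀ x y : A, δ₁ (x * y) = δ₁ x * y + x * δ₁ y)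
    (hδ₂ : ∀ x y : A, δ₂ (x * y) = δ₂ x * y + x * δ₂ y)
    (hcomm : ∀ x : A, δ₁ (δ₂ x) = δ₂ (δ₁ x))
    {τ : A →L[ℂ] ℂ} (htr : ∀ a b : A, τ (a * b) = τ (b * a))
    (hτδ₁ : ∀ a : A, τ (δ₁ a) = 0) (hτδ₂ : ∀ a : A, τ (δ₂ a) = 0)
    {e g : A} (he : e * e = e) (hg : g = g * e + e * g) :
    τ (g * (δ₁ e * δ₂ e - δ₂ e * δ₁ e) +
      e * ((δ₁ g * δ₂ e + δ₁ e * δ₂ g) - (δ₂ g * δ₁ e + δ₂ e * δ₁ g))) = 0 := by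
  have h₁ : δ₁ e = δ₁ e * e + e * δ₁ e := by rw [← hδ₁, he]
  have h₂ : δ₂ e = δ₂ e * e + e * δ₂ e := by rw [← hδ₂, he]
  have h₁₂ : τ (g * (δ₁ e * δ₂ e)) = 0 :=
    trace_mul_eq_zero_of_commute htr he hg (commute_mul_of_eq_mul_add_mul h₁ h₂)
  have h₂₁ : τ (g * (δ₂ e * δ₁ e)) = 0 :=
    trace_mul_eq_zero_of_commute htr he hg (commute_mul_of_eq_mul_add_mul h₂ h₁)
  have k₁ : τ (e * (δ₁ g * δ₂ e)) = -τ (g * δ₁ (δ₂ e * e)) := by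
    rw [← trace_derivation_mul hδ₁ hτδ₁, htr, mul_assoc]
  have k₂ : τ (e * (δ₂ e * δ₁ g)) = -τ (g * δ₁ (e * δ₂ e)) := by
    rw [← trace_derivation_mul hδ₁ hτδ₁, ← mul_assoc, htr]
  have k₃ : τ (e * (δ₂ g * δ₁ e)) = -τ (g * δ₂ (δ₁ e * e)) := by
    rw [← trace_derivation_mul hδ₂ hτδ₂, htr, mul_assoc]
  have k₄ : τ (e * (δ₁ e * δ₂ g)) = -τ (g * δ₂ (e * δ₁ e)) := by
    rw [← trace_derivation_mul hδ₂ hτδ₂, ← mul_assoc, htr]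
  simp only [mul_add, mul_sub, map_add, map_sub, k₁, k₂, k₃, k₄, hδ₁, hδ₂, hcomm, h₁₂, h₂₁]
  ring

end Trace

/-- `c₁` is invariant under continuously differentiable homotopies of
idempotents. -/
theorem chernOne_homotopy_invariant
    {A : Type} [NormedRing A] [NormedAlgebra ℂ A] [CompleteSpace A]
    (δ₁ δ₂ : A →L[ℂ] A)
    (hδ₁ : ∀ x y : A, δ₁ (x * y) = δ₁ x * y + x * δ₁ y)
    (hδ₂ : ∀ x y : A, δ₂ (x * y) = δ₂ x * y + x * δ₂ y)
    (hcomm : ∀ x : A, δ₁ (δ₂ x) = δ₂ (δ₁ x))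
    (τ : A →L[ℂ] ℂ)
    (htr : ∀ a b : A, τ (a * b) = τ (b * a))
    (hτδ₁ : ∀ a : A, τ (δ₁ a) = 0) (hτδ₂ : ∀ a : A, τ (δ₂ a) = 0)
    (e : ℝ → A)
    (hsm : ContDiffOn ℝ 1 e (Set.Icc 0 1))
    (hidem : ∀ t ∈ Set.Icc (0 : ℝ) 1, e t * e t = e t) :
    ∀ s ∈ Set.Icc (0 : ℝ) 1, ∀ t ∈ Set.Icc (0 : ℝ) 1,
      chernOne δ₁ δ₂ τ (e s) = chernOne δ₁ δ₂ τ (e t) := by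
  have hderiv : ∀ t ∈ Set.Icc (0 : ℝ) 1,
      HasDerivWithinAt (fun t => chernOne δ₁ δ₂ τ (e t)) 0 (Set.Icc 0 1) t := by
    intro t ht
    have he : HasDerivWithinAt e (derivWithin e (Set.Icc 0 1) t) (Set.Icc 0 1) t :=
      (hsm.differentiableOn one_ne_zero t ht).hasDerivWithinAt
    set g := derivWithin e (Set.Icc 0 1) t
    have hg : g = g * e t + e t * g :=
      (uniqueDiffOn_Icc zero_lt_one t ht).eq_deriv _ he
        ((he.mul he).congr (fun s hs => (hidem s hs).symm) (hidem t ht).symm)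
    have hd₁ : HasDerivWithinAt (fun s => δ₁ (e s)) (δ₁ g) (Set.Icc 0 1) t :=
      (δ₁.restrictScalars ℝ).hasFDerivAt.comp_hasDerivWithinAt t he
    have hd₂ : HasDerivWithinAt (fun s => δ₂ (e s)) (δ₂ g) (Set.Icc 0 1) t :=
      (δ₂.restrictScalars ℝ).hasFDerivAt.comp_hasDerivWithinAt t he
    have hτ := ((τ.restrictScalars ℝ).hasFDerivAt.comp_hasDerivWithinAt t
      (he.mul ((hd₁.mul hd₂).sub (hd₂.mul hd₁)))).const_mul
        (1 / (2 * (Real.pi : ℂ) * Complex.I))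
    refine hτ.congr_deriv ?_
    exact mul_eq_zero_of_right _
      (trace_variation_eq_zero hδ₁ hδ₂ hcomm htr hτδ₁ hτδ₂ (hidem t ht) hg)
  have hconst : ∀ t ∈ Set.Icc (0 : ℝ) 1,
      chernOne δ₁ δ₂ τ (e t) = chernOne δ₁ δ₂ τ (e 0) :=
    constant_of_derivWithin_zero (fun t ht => (hderiv t ht).differentiableWithinAt)
      fun t ht => (hderiv t (Set.Ico_subset_Icc_self ht)).derivWithin
        (uniqueDiffOn_Icc zero_lt_one t (Set.Ico_subset_Icc_self ht))
  intro s hs t ht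
  rw [hconst s hs, hconst t ht]
end

section
/- The first Chern number c_1 is additive on orthogonal idempotents: if e, f ∈ A are idempotents with ef = fe = 0, then e + f is an idempotent and c_1(e + f) = c_1(e) + c_1(f). -/
section TraceIdentities

variable {R G : Type*} [Ring R] [AddCommGroup G] (τ : R →+ G)

/-- For a trace `τ` and orthogonal elements `e`, `f` with infinitesimal variations `e₁`, `f₁`,
one can trade `e * f₁` for `-(e₁ * f)` under the trace. -/
lemma trace_mul_variation_mul (htr : ∀ a b : R, τ (a * b) = τ (b * a))
    {e f e₁ f₁ : R} (h : e₁ * f + e * f₁ = 0) (x : R) :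
    τ (e * f₁ * x) = -τ (f * x * e₁) := by
  rw [eq_neg_of_add_eq_zero_right h, neg_mul, map_neg, mul_assoc, htr]

/-- The trace of `e * f₁ * f₂` with both variations taken in the second idempotent. -/
lemma trace_mul_variation_mul_variation (htr : ∀ a b : R, τ (a * b) = τ (b * a))
    {e f e₁ e₂ f₁ f₂ : R} (he : e * e = e) (hf : f * f = f)
    (h₁ : e₁ * f + e * f₁ = 0) (h₂ : f₂ * e + f * e₂ = 0) :
    τ (e * f₁ * f₂) = τ (f * e₂ * e₁) := by
  have key : e * f₁ * (f₂ * e) = e₁ * (f * e₂) := by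
    rw [eq_neg_of_add_eq_zero_right h₁, eq_neg_of_add_eq_zero_left h₂, neg_mul_neg,
      mul_assoc, ← mul_assoc f f, hf]
  calc τ (e * f₁ * f₂) = τ (e * (e * (f₁ * f₂))) := by rw [← mul_assoc e e, he, mul_assoc]
    _ = τ (e * f₁ * (f₂ * e)) := by rw [htr]; simp only [mul_assoc]
    _ = τ (f * e₂ * e₁) := by rw [key, htr]

/-- The trace of `e * e₁ * f₂` with one variation taken in each idempotent. -/
lemma trace_mul_self_variation_mul_variation (htr : ∀ a b : R, τ (a * b) = τ (b * a))
    {e f e₁ e₂ f₂ : R} (he : e * e = e) (hef : e * f = 0)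
    (he₁ : e₁ * e + e * e₁ = e₁) (h₂ : f₂ * e + f * e₂ = 0) :
    τ (e * e₁ * f₂) = -τ (f * e₂ * e₁) := by
  have key : e * e₁ * f = e₁ * f := by
    rw [eq_sub_of_add_eq' he₁, sub_mul, mul_assoc e₁, hef, mul_zero, sub_zero]
  calc τ (e * e₁ * f₂) = τ (e * (e * (e₁ * f₂))) := by rw [← mul_assoc e e, he, mul_assoc]
    _ = τ (e * e₁ * (f₂ * e)) := by rw [htr]; simp only [mul_assoc]
    _ = -τ (f * e₂ * e₁) := by
      rw [eq_neg_of_add_eq_zero_left h₂, mul_neg, map_neg, ← mul_assoc, key, mul_assoc, htr]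

/-- Additivity of the trace of `e * (e₁ * e₂ - e₂ * e₁)` on orthogonal idempotents, where
`eᵢ` and `fᵢ` satisfy the relations of the values at `e` and `f` of two derivations. -/
lemma trace_curvature_add (htr : ∀ a b : R, τ (a * b) = τ (b * a))
    {e f e₁ e₂ f₁ f₂ : R} (he : e * e = e) (hf : f * f = f) (hef : e * f = 0) (hfe : f * e = 0)
    (he₁ : e₁ * e + e * e₁ = e₁) (he₂ : e₂ * e + e * e₂ = e₂)
    (hf₁ : f₁ * f + f * f₁ = f₁) (hf₂ : f₂ * f + f * f₂ = f₂)
    (hef₁ : e₁ * f + e * f₁ = 0) (hef₂ : e₂ * f + e * f₂ = 0)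
    (hfe₁ : f₁ * e + f * e₁ = 0) (hfe₂ : f₂ * e + f * e₂ = 0) :
    τ ((e + f) * ((e₁ + f₁) * (e₂ + f₂) - (e₂ + f₂) * (e₁ + f₁))) =
      τ (e * (e₁ * e₂ - e₂ * e₁)) + τ (f * (f₁ * f₂ - f₂ * f₁)) := by
  simp only [add_mul, mul_add, mul_sub, map_add, map_sub, ← mul_assoc]
  rw [trace_mul_variation_mul_variation τ htr he hf hef₁ hfe₂,
    trace_mul_variation_mul_variation τ htr he hf hef₂ hfe₁,
    trace_mul_variation_mul τ htr hef₁ e₂, trace_mul_variation_mul τ htr hef₂ e₁,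
    trace_mul_variation_mul τ htr hfe₁ f₂, trace_mul_variation_mul τ htr hfe₂ f₁,
    trace_mul_self_variation_mul_variation τ htr he hef he₁ hfe₂,
    trace_mul_self_variation_mul_variation τ htr he hef he₂ hfe₁,
    trace_mul_self_variation_mul_variation τ htr hf hfe hf₁ hef₂,
    trace_mul_self_variation_mul_variation τ htr hf hfe hf₂ hef₁,
    trace_mul_variation_mul_variation τ htr he hf hef₁ hfe₂,
    trace_mul_variation_mul_variation τ htr he hf hef₂ hfe₁]
  abel

end TraceIdentities

/-- `c₁` is additive on orthogonal idempotents. -/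
theorem chernOne_additive_orthogonal
    {A : Type} [NormedRing A] [NormedAlgebra ℂ A] [CompleteSpace A]
    (δ₁ δ₂ : A →L[ℂ] A)
    (hδ₁ : ∀ x y : A, δ₁ (x * y) = δ₁ x * y + x * δ₁ y)
    (hδ₂ : ∀ x y : A, δ₂ (x * y) = δ₂ x * y + x * δ₂ y)
    (hcomm : ∀ x : A, δ₁ (δ₂ x) = δ₂ (δ₁ x))
    (τ : A →L[ℂ] ℂ)
    (htr : ∀ a b : A, τ (a * b) = τ (b * a))
    (hτδ₁ : ∀ a : A, τ (δ₁ a) = 0) (hτδ₂ : ∀ a : A, τ (δ₂ a) = 0)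
    (e f : A) (he : e * e = e) (hf : f * f = f)
    (hef : e * f = 0) (hfe : f * e = 0) :
    (e + f) * (e + f) = e + f ∧
      chernOne δ₁ δ₂ τ (e + f) = chernOne δ₁ δ₂ τ e + chernOne δ₁ δ₂ τ f := by
  refine ⟨by simp [add_mul, mul_add, he, hf, hef, hfe], ?_⟩
  have h := trace_curvature_add (τ : A →+ ℂ) htr he hf hef hfe
    (by rw [← hδ₁, he] : δ₁ e * e + e * δ₁ e = δ₁ e)
    (by rw [← hδ₂, he] : δ₂ e * e + e * δ₂ e = δ₂ e)
    (by rw [← hδ₁, hf] : δ₁ f * f + f * δ₁ f = δ₁ f)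
    (by rw [← hδ₂, hf] : δ₂ f * f + f * δ₂ f = δ₂ f)
    (by rw [← hδ₁, hef, map_zero]) (by rw [← hδ₂, hef, map_zero])
    (by rw [← hδ₁, hfe, map_zero]) (by rw [← hδ₂, hfe, map_zero])
  simp only [AddMonoidHom.coe_coe] at h
  simp only [chernOne, map_add δ₁, map_add δ₂]
  rw [h, mul_add]
end

section
/- If an idempotent e ∈ A can be joined to an idempotent fixed by the first flow, then c_1(e) = 0: suppose t ↦ e(t) is a continuously differentiable map from [0,1] to A with e(t)² = e(t) for all t, e(0) = e, and δ_1(e(1)) = 0; then c_1(e) = 0. -/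
/-- A trace vanishes on a product of three elements that are off-diagonal with respect to an
idempotent. -/
theorem trace_mul_mul_eq_zero_of_offDiagonal {A : Type} [Ring A] (τ : A →+ ℂ)
    (htr : ∀ a b : A, τ (a * b) = τ (b * a)) {p x y z : A} (hp : p * p = p)
    (hx : x * p + p * x = x) (hy : y * p + p * y = y) (hz : z * p + p * z = z) :
    τ (x * y * z) = 0 := by
  obtain ⟨u, hu⟩ : ∃ u, u = p + p - 1 := ⟨_, rfl⟩
  have huu : u * u = 1 := by
    have : u * u = p * p + p * p + p * p + p * p - p - p - p - p + 1 := by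
      rw [hu]; noncomm_ring
    rw [this, hp]; abel
  have anti : ∀ w : A, w * p + p * w = w → u * w = -(w * u) := by
    intro w hw
    have : u * w + w * u = (w * p + p * w) + (w * p + p * w) - w - w := by
      rw [hu]; noncomm_ring
    rw [hw] at this
    exact eq_neg_of_add_eq_zero_left (by rw [this]; abel)
  have key : u * (x * y * z) = -(x * y * z * u) := by
    calc u * (x * y * z) = (u * x) * y * z := by noncomm_ring
      _ = -(x * (u * y) * z) := by rw [anti x hx]; noncomm_ring
      _ = x * y * (u * z) := by rw [anti y hy]; noncomm_ring
      _ = -(x * y * z * u) := by rw [anti z hz]; noncomm_ring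
  have h : τ (x * y * z) = -τ (x * y * z) := by
    calc τ (x * y * z) = τ (u * (u * (x * y * z))) := by rw [← mul_assoc, huu, one_mul]
      _ = τ (u * (x * y * z) * u) := htr _ _
      _ = -τ (x * y * z * (u * u)) := by rw [key, neg_mul, map_neg, mul_assoc _ u u]
      _ = -τ (x * y * z) := by rw [huu, mul_one]
  exact self_eq_neg.mp h

/-- The first variation of `τ(p(δ₁(p)δ₂(p) - δ₂(p)δ₁(p)))` at an idempotent `p`, in a direction
`h` tangent to the idempotents, is zero. -/
theorem trace_curvature_variation_eq_zero {A : Type} [Ring A] (δ₁ δ₂ : A →+ A)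
    (hδ₁ : ∀ x y : A, δ₁ (x * y) = δ₁ x * y + x * δ₁ y)
    (hδ₂ : ∀ x y : A, δ₂ (x * y) = δ₂ x * y + x * δ₂ y)
    (hcomm : ∀ x : A, δ₁ (δ₂ x) = δ₂ (δ₁ x))
    (τ : A →+ ℂ) (htr : ∀ a b : A, τ (a * b) = τ (b * a))
    (hτδ₁ : ∀ a : A, τ (δ₁ a) = 0) (hτδ₂ : ∀ a : A, τ (δ₂ a) = 0)
    {p h : A} (hp : p * p = p) (hh : h * p + p * h = h) :
    τ (h * (δ₁ p * δ₂ p - δ₂ p * δ₁ p) + p * ((δ₁ h * δ₂ p + δ₁ p * δ₂ h)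
      - (δ₂ h * δ₁ p + δ₂ p * δ₁ h))) = 0 := by
  have h₁ : δ₁ p * p + p * δ₁ p = δ₁ p := by rw [← hδ₁, hp]
  have h₂ : δ₂ p * p + p * δ₂ p = δ₂ p := by rw [← hδ₂, hp]
  have t₁₂ := trace_mul_mul_eq_zero_of_offDiagonal τ htr hp hh h₁ h₂
  have t₂₁ := trace_mul_mul_eq_zero_of_offDiagonal τ htr hp hh h₂ h₁
  have parts₁ := hτδ₁ (h * (δ₂ p * p - p * δ₂ p))
  have parts₂ := hτδ₂ (h * (p * δ₁ p - δ₁ p * p))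
  have c₁ := htr p (δ₁ h * δ₂ p)
  have c₂ := htr (p * δ₁ p) (δ₂ h)
  have c₃ := htr p (δ₂ h * δ₁ p)
  have c₄ := htr (p * δ₂ p) (δ₁ h)
  simp only [hδ₁, hδ₂, hcomm, mul_add, add_mul, mul_sub, map_add, map_sub, ← mul_assoc]
    at parts₁ parts₂ c₁ c₂ c₃ c₄ t₁₂ t₂₁ ⊢
  linear_combination parts₁ + parts₂ + c₁ + c₂ - c₃ - c₄ + 3 * t₁₂ - 3 * t₂₁

/-- if an idempotent can be joined by a `C¹` path of idempotents to an
idempotent fixed by the first flow (`δ₁(e(1)) = 0`), then its first Chern number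
vanishes. -/
theorem chernOne_eq_zero_of_homotopic_to_flow_invariant
    {A : Type} [NormedRing A] [NormedAlgebra ℂ A] [CompleteSpace A]
    (δ₁ δ₂ : A →L[ℂ] A)
    (hδ₁ : ∀ x y : A, δ₁ (x * y) = δ₁ x * y + x * δ₁ y)
    (hδ₂ : ∀ x y : A, δ₂ (x * y) = δ₂ x * y + x * δ₂ y)
    (hcomm : ∀ x : A, δ₁ (δ₂ x) = δ₂ (δ₁ x))
    (τ : A →L[ℂ] ℂ)
    (htr : ∀ a b : A, τ (a * b) = τ (b * a))
    (hτδ₁ : ∀ a : A, τ (δ₁ a) = 0) (hτδ₂ : ∀ a : A, τ (δ₂ a) = 0)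
    (e : ℝ → A)
    (hsm : ContDiffOn ℝ 1 e (Set.Icc 0 1))
    (hidem : ∀ t ∈ Set.Icc (0 : ℝ) 1, e t * e t = e t)
    (hfix : δ₁ (e 1) = 0) :
    chernOne δ₁ δ₂ τ (e 0) = 0 := by
  have hd : ∀ t ∈ Set.Icc (0 : ℝ) 1,
      HasDerivWithinAt e (derivWithin e (Set.Icc 0 1) t) (Set.Icc 0 1) t := fun t ht =>
    (hsm.differentiableOn one_ne_zero t ht).hasDerivWithinAt
  have htan : ∀ t ∈ Set.Icc (0 : ℝ) 1,
      derivWithin e (Set.Icc 0 1) t * e t + e t * derivWithin e (Set.Icc 0 1) t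
        = derivWithin e (Set.Icc 0 1) t := fun t ht =>
    (uniqueDiffOn_Icc zero_lt_one t ht).eq_deriv _
      (((hd t ht).mul (hd t ht)).congr (fun s hs => (hidem s hs).symm) (hidem t ht).symm) (hd t ht)
  have hf : ∀ t ∈ Set.Icc (0 : ℝ) 1, HasDerivWithinAt
      (fun s => τ (e s * (δ₁ (e s) * δ₂ (e s) - δ₂ (e s) * δ₁ (e s)))) 0 (Set.Icc 0 1) t := by
    intro t ht
    have he := hd t ht
    have he₁ := (δ₁.restrictScalars ℝ).hasFDerivAt.comp_hasDerivWithinAt t he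
    have he₂ := (δ₂.restrictScalars ℝ).hasFDerivAt.comp_hasDerivWithinAt t he
    have := (τ.restrictScalars ℝ).hasFDerivAt.comp_hasDerivWithinAt t
      (he.mul ((he₁.mul he₂).sub (he₂.mul he₁)))
    refine this.congr_deriv ?_
    exact trace_curvature_variation_eq_zero (δ₁ : A →+ A) (δ₂ : A →+ A) hδ₁ hδ₂ hcomm (τ : A →+ ℂ)
      htr hτδ₁ hτδ₂ (hidem t ht) (htan t ht)
  have hconst := constant_of_derivWithin_zero
    (fun t ht => (hf t ht).differentiableWithinAt)
    (fun t ht => (hf t (Set.Ico_subset_Icc_self ht)).derivWithin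
      (uniqueDiffOn_Icc zero_lt_one t (Set.Ico_subset_Icc_self ht)))
    1 (Set.right_mem_Icc.mpr zero_le_one)
  simp only [hfix, zero_mul, mul_zero, sub_zero, map_zero] at hconst
  rw [chernOne, ← hconst, mul_zero]
end

section
/- The odd Chern character integrand is invariant under differentiable homotopies of invertibles: if u : [0,1] → A is continuously differentiable and u(t) is invertible in A for every t ∈ [0,1], then the function t ↦ τ( δ(u(t))·u(t)⁻¹ ) is constant on [0,1]. -/
/-- A map satisfying the Leibniz rule sends the inverse of a unit `x` to `-x⁻¹ * δ x * x⁻¹`. -/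
theorem leibniz_units_inv {A : Type*} [Ring A] (δ : A →+ A)
    (hδ : ∀ x y : A, δ (x * y) = δ x * y + x * δ y) (x : Aˣ) :
    δ ↑x⁻¹ = -(↑x⁻¹ * δ x * ↑x⁻¹) := by
  have h1 : δ 1 = 0 := by simpa using hδ 1 1
  have h := hδ x ↑x⁻¹
  rw [Units.mul_inv, h1] at h
  have h' := congrArg (fun z => (↑x⁻¹ : A) * z) h
  simp only [mul_zero, mul_add, ← mul_assoc, Units.inv_mul, one_mul] at h'
  exact eq_neg_of_add_eq_zero_right h'.symm

/-- The integrand `τ(δ(u)u⁻¹)` has zero derivative along a differentiable path through a unit. -/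
theorem hasDerivWithinAt_trace_leibniz_mul_inverse
    {A : Type*} [NormedRing A] [NormedAlgebra ℂ A] [CompleteSpace A]
    (δ : A →L[ℂ] A) (hδ : ∀ x y : A, δ (x * y) = δ x * y + x * δ y)
    (τ : A →L[ℂ] ℂ) (htr : ∀ a b : A, τ (a * b) = τ (b * a)) (hτδ : ∀ a : A, τ (δ a) = 0)
    {u : ℝ → A} {u' : A} {s : Set ℝ} {t : ℝ} (hu : HasDerivWithinAt u u' s t)
    (ht : IsUnit (u t)) :
    HasDerivWithinAt (fun r => τ (δ (u r) * Ring.inverse (u r))) 0 s t := by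
  obtain ⟨x, hx⟩ := ht
  have hinv : HasDerivWithinAt (fun r => Ring.inverse (u r)) (-(↑x⁻¹ * u' * ↑x⁻¹)) s t := by
    have h := hasFDerivAt_ringInverse (𝕜 := ℝ) x
    rw [hx] at h
    simpa [Function.comp_def] using h.comp_hasDerivWithinAt t hu
  have hδu : HasDerivWithinAt (fun r => δ (u r)) (δ u') s t :=
    (δ.restrictScalars ℝ).hasFDerivAt.comp_hasDerivWithinAt t hu
  have h : HasDerivWithinAt (fun r => τ (δ (u r) * Ring.inverse (u r)))
      (τ (δ u' * Ring.inverse (u t) + δ (u t) * -(↑x⁻¹ * u' * ↑x⁻¹))) s t :=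
    (τ.restrictScalars ℝ).hasFDerivAt.comp_hasDerivWithinAt t (hδu.mul hinv)
  convert h using 1
  rw [← hx, Ring.inverse_unit, ← hτδ (u' * ↑x⁻¹), hδ,
    show δ (↑x⁻¹ : A) = _ from leibniz_units_inv (δ : A →+ A) hδ x]
  have hcomm := htr (u' * ↑x⁻¹) (δ x * ↑x⁻¹)
  simp only [mul_assoc, mul_neg, map_add, map_neg, AddMonoidHom.coe_coe] at hcomm ⊢
  rw [hcomm]

/-- the odd Chern character integrand `τ(δ(u)u⁻¹)` is invariant under
continuously differentiable homotopies of invertibles. -/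
theorem odd_chern_integrand_homotopy_invariant
    {A : Type} [NormedRing A] [NormedAlgebra ℂ A] [CompleteSpace A]
    (δ : A →L[ℂ] A)
    (hδ : ∀ x y : A, δ (x * y) = δ x * y + x * δ y)
    (τ : A →L[ℂ] ℂ)
    (htr : ∀ a b : A, τ (a * b) = τ (b * a))
    (hτδ : ∀ a : A, τ (δ a) = 0)
    (u : ℝ → A)
    (hsm : ContDiffOn ℝ 1 u (Set.Icc 0 1))
    (hu : ∀ t ∈ Set.Icc (0 : ℝ) 1, IsUnit (u t)) :
    ∀ s ∈ Set.Icc (0 : ℝ) 1, ∀ t ∈ Set.Icc (0 : ℝ) 1,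
      τ (δ (u s) * Ring.inverse (u s)) = τ (δ (u t) * Ring.inverse (u t)) := by
  have hderiv : ∀ r ∈ Set.Icc (0 : ℝ) 1, HasDerivWithinAt
      (fun r => τ (δ (u r) * Ring.inverse (u r))) 0 (Set.Icc 0 1) r := fun r hr =>
    hasDerivWithinAt_trace_leibniz_mul_inverse δ hδ τ htr hτδ
      ((hsm.differentiableOn one_ne_zero) r hr).hasDerivWithinAt (hu r hr)
  intro s hs t ht
  have h := (convex_Icc (0 : ℝ) 1).norm_image_sub_le_of_norm_hasDerivWithin_le (C := 0)
    hderiv (fun _ _ => by simp) ht hs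
  rw [zero_mul] at h
  exact sub_eq_zero.mp (norm_le_zero_iff.mp h)
end

section
/- The first Chern number of the Powers–Rieffel projection equals 1: under the stated conditions on f and g one has −6 ∫₀¹ g(t)² f'(t) dt = 1. -/
/-- for the Powers–Rieffel functions `f, g` relative to
`θ ∈ (1/2, 1)`, one has `-6 ∫₀¹ g(t)² f'(t) dt = 1`. -/
theorem powers_rieffel_chern_integral
    (θ : ℝ) (hθ : θ ∈ Set.Ioo (1 / 2 : ℝ) 1)
    (f g : ℝ → ℝ)
    (hf : ContDiff ℝ 1 f) (hfp : Function.Periodic f 1)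
    (hg : Continuous g) (hgp : Function.Periodic g 1)
    (hf1 : ∀ s ∈ Set.Icc (1 - θ) θ, f s = 1)
    (hf2 : ∀ s ∈ Set.Icc θ 1, f s = 1 - f (s - θ))
    (hg1 : ∀ s ∈ Set.Icc (0 : ℝ) θ, g s = 0)
    (hg2 : ∀ s ∈ Set.Icc θ 1, g s ^ 2 = f s - f s ^ 2) :
    -6 * ∫ t in (0 : ℝ)..1, g t ^ 2 * deriv f t = 1 := by
  obtain ⟨hθ0, hθ1⟩ := hθ
  have hd : Continuous (deriv f) := hf.continuous_deriv le_rfl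
  have hfθ : f θ = 1 := hf1 θ ⟨by linarith, le_rfl⟩
  have hfone : f 1 = 0 := by
    rw [hf2 1 ⟨hθ1.le, le_rfl⟩, hf1 (1 - θ) ⟨le_rfl, by linarith⟩, sub_self]
  have hint : ∀ a b : ℝ,
      IntervalIntegrable (fun t => g t ^ 2 * deriv f t) MeasureTheory.volume a b :=
    fun a b => ((hg.pow 2).mul hd).intervalIntegrable a b
  have hleft : ∫ t in (0 : ℝ)..θ, g t ^ 2 * deriv f t = 0 := by
    refine intervalIntegral.integral_zero_ae (.of_forall fun t ht => ?_)
    rw [Set.uIoc_of_le (by linarith)] at ht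
    simp [hg1 t ⟨ht.1.le, ht.2⟩]
  have hright : ∫ t in θ..1, g t ^ 2 * deriv f t = -1 / 6 := by
    have hcongr : ∫ t in θ..1, g t ^ 2 * deriv f t =
        ∫ t in θ..1, (f t - f t ^ 2) * deriv f t := by
      refine intervalIntegral.integral_congr fun t ht => ?_
      rw [Set.uIcc_of_le hθ1.le] at ht
      simp only [hg2 t ht]
    have hderiv : ∀ t ∈ Set.uIcc θ 1, HasDerivAt (fun t => f t ^ 2 / 2 - f t ^ 3 / 3)
        ((f t - f t ^ 2) * deriv f t) t := fun t _ => by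
      have h := (hf.differentiable one_ne_zero t).hasDerivAt
      refine (((h.pow 2).div_const 2).sub ((h.pow 3).div_const 3)).congr_deriv ?_
      push_cast
      ring
    rw [hcongr, intervalIntegral.integral_eq_sub_of_hasDerivAt hderiv
      (((hf.continuous.sub (hf.continuous.pow 2)).mul hd).intervalIntegrable _ _), hfθ, hfone]
    norm_num
  rw [← intervalIntegral.integral_add_adjacent_intervals (hint 0 θ) (hint θ 1), hleft, hright]
  norm_num
end

section
/- The Powers–Rieffel element is a selfadjoint idempotent: e_0 := g(u_1)·u_2 + f(u_1) + u_2*·g(u_1) satisfies e_0* = e_0 and e_0² = e_0. Here h(u_1), for h a continuous 1-periodic function on ℝ, denotes the continuous functional calculus of the unitary u_1 applied to the continuous function on the unit circle induced by h. -/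
/-- A continuous star-homomorphism on `C(ℝ/Tℤ, ℂ)` is determined by its value at the first
Fourier monomial. -/
theorem AddCircle.starAlgHom_ext_fourier_one {T : ℝ} [Fact (0 < T)] {B : Type*} [Ring B]
    [Algebra ℂ B] [StarRing B] [TopologicalSpace B] [T2Space B]
    {φ ψ : C(AddCircle T, ℂ) →⋆ₐ[ℂ] B} (hφ : Continuous φ) (hψ : Continuous ψ)
    (h : φ (fourier 1) = ψ (fourier 1)) : φ = ψ := by
  have h_neg : φ (fourier (-1)) = ψ (fourier (-1)) := by
    have hstar : (fourier (-1) : C(AddCircle T, ℂ)) = star (fourier 1) := by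
      ext x
      simp only [fourier_neg, ContinuousMap.star_apply]
      rfl
    rw [hstar, map_star, map_star, h]
  have h_add (m n : ℤ) :
      (fourier (m + n) : C(AddCircle T, ℂ)) = fourier m * fourier n := by
    ext x
    simp only [fourier_add, ContinuousMap.mul_apply]
  have h_zero : (fourier 0 : C(AddCircle T, ℂ)) = 1 := by
    ext x
    simp only [fourier_zero, ContinuousMap.one_apply]
  have h_fourier (n : ℤ) : φ (fourier n) = ψ (fourier n) := by
    induction n with
    | zero => rw [h_zero, map_one, map_one]
    | succ n ih => rw [h_add, map_mul, map_mul, ih, h]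
    | pred n ih => rw [sub_eq_add_neg, h_add, map_mul, map_mul, ih, h_neg]
  have h_dense : Dense (Submodule.span ℂ (Set.range (fourier (T := T))) : Set C(AddCircle T, ℂ)) :=
    Submodule.dense_iff_topologicalClosure_eq_top.mpr span_fourier_closure_eq_top
  have h_eqOn : Set.EqOn φ ψ (Submodule.span ℂ (Set.range (fourier (T := T)))) := by
    have h_range : Set.EqOn φ.toAlgHom.toLinearMap ψ.toAlgHom.toLinearMap
        (Set.range (fourier (T := T))) := by
      rintro _ ⟨n, rfl⟩
      exact h_fourier n
    exact LinearMap.eqOn_span h_range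
  exact DFunLike.coe_injective (Continuous.ext_on h_dense hφ hψ h_eqOn)

open scoped CStarAlgebra in
/-- If `u` is a unitary with `Φ (e^{2πit}) u = e^{2πiθ} u Φ (e^{2πit})`, then moving `u` past
`Φ H` translates `H` by `θ`. -/
theorem AddCircle.starAlgHom_mul_unitary_eq {A : Type*} [CStarAlgebra A]
    (Φ : C(AddCircle (1 : ℝ), ℂ) →⋆ₐ[ℂ] A) {u : A} (hu : u ∈ unitary A) (θ : ℝ)
    (h : Φ (fourier 1) * u
      = Complex.exp (2 * (Real.pi : ℂ) * Complex.I * (θ : ℂ)) • (u * Φ (fourier 1)))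
    (H : C(AddCircle (1 : ℝ), ℂ)) :
    Φ H * u = u * Φ (H.comp (ContinuousMap.addRight (θ : AddCircle (1 : ℝ)))) := by
  let shift : C(AddCircle (1 : ℝ), AddCircle (1 : ℝ)) :=
    ContinuousMap.addRight (θ : AddCircle (1 : ℝ))
  let U : unitary A := ⟨u, hu⟩
  let φ : C(AddCircle (1 : ℝ), ℂ) →⋆ₐ[ℂ] A :=
    (Unitary.conjStarAlgAut ℂ A (star U) : A →⋆ₐ[ℂ] A).comp Φ
  let ψ : C(AddCircle (1 : ℝ), ℂ) →⋆ₐ[ℂ] A := Φ.comp (shift.compStarAlgHom' ℂ ℂ)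
  have hφ_apply (K : C(AddCircle (1 : ℝ), ℂ)) : φ K = star u * Φ K * u := by
    simp [φ, U, Unitary.conjStarAlgAut_apply]
  have h_shift : (fourier 1 : C(AddCircle (1 : ℝ), ℂ)).comp shift
      = Complex.exp (2 * (Real.pi : ℂ) * Complex.I * (θ : ℂ)) • fourier 1 := by
    ext x
    induction x using QuotientAddGroup.induction_on with
    | H t =>
      change (fourier 1 : C(AddCircle (1 : ℝ), ℂ)) ((t : AddCircle (1 : ℝ)) + θ)
        = Complex.exp _ * (fourier 1 : C(AddCircle (1 : ℝ), ℂ)) (t : AddCircle (1 : ℝ))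
      rw [← AddCircle.coe_add, fourier_coe_apply, fourier_coe_apply, ← Complex.exp_add]
      congr 1
      push_cast
      ring
  have h_eq : φ = ψ := by
    refine starAlgHom_ext_fourier_one (map_continuous φ) (map_continuous ψ) ?_
    change _ = Φ ((fourier 1 : C(AddCircle (1 : ℝ), ℂ)).comp shift)
    rw [hφ_apply, h_shift, map_smul, mul_assoc, h, mul_smul_comm, ← mul_assoc,
      Unitary.star_mul_self_of_mem hu, one_mul]
  have h_conj : star u * Φ H * u = Φ (H.comp shift) := by
    rw [← hφ_apply, h_eq]
    rfl
  rw [← h_conj, mul_assoc, ← mul_assoc, Unitary.mul_star_self_of_mem hu, one_mul]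

/-- Algebraic criterion for `a u + b + u* a` to be idempotent, where `a'` and `b'` are the
conjugates of `a` and `b` by the unitary `u`. -/
theorem isIdempotentElem_mul_unitary_add_add_star_mul {A : Type*} [Ring A] [StarRing A]
    {u a b a' b' : A} (hu : u ∈ unitary A) (ha : a * u = u * a') (hb : b * u = u * b')
    (h_disjoint : a' * a = 0) (h_disjoint' : a * a' = 0)
    (h_linear : a' * b + b' * a' = a') (h_linear' : b * a' + a' * b' = a')
    (h_quadratic : a * a + b * b + a' * a' = b) :
    IsIdempotentElem (a * u + b + star u * a) := by
  have hsu := Unitary.star_mul_self_of_mem hu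
  have hus := Unitary.mul_star_self_of_mem hu
  have ha' : star u * a = a' * star u := by
    calc star u * a = star u * (a * u) * star u := by simp only [mul_assoc, hus, mul_one]
      _ = a' * star u := by rw [ha, ← mul_assoc, hsu, one_mul]
  have hb' : star u * b = b' * star u := by
    calc star u * b = star u * (b * u) * star u := by simp only [mul_assoc, hus, mul_one]
      _ = b' * star u := by rw [hb, ← mul_assoc, hsu, one_mul]
  have h_uu : a * u * (a * u) = 0 := by
    calc a * u * (a * u) = u * (a' * a) * u := by
          nth_rw 1 [ha]
          simp only [mul_assoc]
      _ = 0 := by rw [h_disjoint, mul_zero, zero_mul]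
  have h_ss : star u * a * (star u * a) = 0 := by
    calc star u * a * (star u * a) = star u * (a * a') * star u := by
          nth_rw 2 [ha']
          simp only [mul_assoc]
      _ = 0 := by rw [h_disjoint', mul_zero, zero_mul]
  have h_u : a * u * b + b * (a * u) = a * u := by
    calc a * u * b + b * (a * u) = u * (a' * b + b' * a') := by
          rw [ha, ← mul_assoc b, hb, mul_assoc, mul_assoc, ← mul_add]
      _ = a * u := by rw [h_linear, ha]
  have h_s : star u * a * b + b * (star u * a) = star u * a := by
    calc star u * a * b + b * (star u * a) = (b * a' + a' * b') * star u := by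
          rw [ha', mul_assoc a', hb', ← mul_assoc, ← mul_assoc, add_comm, add_mul]
      _ = star u * a := by rw [h_linear', ha']
  have h_us : a * u * (star u * a) = a * a := by
    rw [mul_assoc, ← mul_assoc u, hus, one_mul]
  have h_su : star u * a * (a * u) = a' * a' := by
    rw [ha', ha, mul_assoc, ← mul_assoc (star u), hsu, one_mul]
  calc (a * u + b + star u * a) * (a * u + b + star u * a)
      = a * u * (a * u) + star u * a * (star u * a) + (a * u * b + b * (a * u))
        + (star u * a * b + b * (star u * a))
        + (a * u * (star u * a) + b * b + star u * a * (a * u)) := by noncomm_ring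
    _ = a * u + b + star u * a := by
      rw [h_uu, h_ss, h_u, h_s, h_us, h_su, h_quadratic]
      abel

/-- Every point of `ℝ/ℤ` has a representative in `[0, 1]`. -/
theorem AddCircle.exists_mem_Icc_coe_eq (x : AddCircle (1 : ℝ)) :
    ∃ t ∈ Set.Icc (0 : ℝ) 1, (t : AddCircle (1 : ℝ)) = x := by
  have hx : x ∈ ((↑) : ℝ → AddCircle (1 : ℝ)) '' Set.Icc 0 (0 + 1) := by
    rw [AddCircle.coe_image_Icc_eq]
    trivial
  simpa using hx


/-- the Powers–Rieffel element
`e₀ = g(u₁)u₂ + f(u₁) + u₂* g(u₁)` is a selfadjoint idempotent.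
Here `h(u₁)` is expressed through a unital *-homomorphism `Φ` from the continuous
functions on the circle `ℝ/ℤ` to `A` sending `t ↦ e^{2πit}` to `u₁` (the continuous
functional calculus of the unitary `u₁`). -/
theorem powers_rieffel_projection_selfadjoint_idempotent
    (θ : ℝ) (hθ : θ ∈ Set.Ioo (1 / 2 : ℝ) 1)
    {A : Type} [NormedRing A] [StarRing A] [CStarRing A]
    [NormedAlgebra ℂ A] [CompleteSpace A] [StarModule ℂ A]
    (u₁ u₂ : A) (hu₁ : u₁ ∈ unitary A) (hu₂ : u₂ ∈ unitary A)
    (hcomm : u₁ * u₂ = Complex.exp (2 * (Real.pi : ℂ) * Complex.I * (θ : ℂ)) • (u₂ * u₁))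
    (f g : ℝ → ℝ)
    (hf : Continuous f) (hfp : Function.Periodic f 1)
    (hg : Continuous g) (hgp : Function.Periodic g 1)
    (hf1 : ∀ s ∈ Set.Icc (1 - θ) θ, f s = 1)
    (hf2 : ∀ s ∈ Set.Icc θ 1, f s = 1 - f (s - θ))
    (hg1 : ∀ s ∈ Set.Icc (0 : ℝ) θ, g s = 0)
    (hg2 : ∀ s ∈ Set.Icc θ 1, g s ^ 2 = f s - f s ^ 2)
    (F G E : C(AddCircle (1 : ℝ), ℂ))
    (hF : ∀ t : ℝ, F (t : AddCircle (1 : ℝ)) = (f t : ℂ))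
    (hG : ∀ t : ℝ, G (t : AddCircle (1 : ℝ)) = (g t : ℂ))
    (hE : ∀ t : ℝ, E (t : AddCircle (1 : ℝ))
        = Complex.exp (2 * (Real.pi : ℂ) * Complex.I * (t : ℂ)))
    (Φ : C(AddCircle (1 : ℝ), ℂ) →⋆ₐ[ℂ] A) (hΦ : Φ E = u₁)
    (e₀ : A) (he₀ : e₀ = Φ G * u₂ + Φ F + star u₂ * Φ G) :
    star e₀ = e₀ ∧ e₀ * e₀ = e₀ := by
  obtain ⟨hθ₁, hθ₂⟩ := hθ
  let _ : CStarAlgebra A := {}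
  have hE_fourier : E = fourier 1 := by
    ext x
    induction x using QuotientAddGroup.induction_on with
    | H t =>
      refine (hE t).trans ?_
      rw [fourier_coe_apply]
      simp
  have h_shift (H : C(AddCircle (1 : ℝ), ℂ)) :
      Φ H * u₂ = u₂ * Φ (H.comp (ContinuousMap.addRight (θ : AddCircle (1 : ℝ)))) := by
    refine AddCircle.starAlgHom_mul_unitary_eq Φ hu₂ θ ?_ H
    rw [← hE_fourier, hΦ, hcomm]
  set F' := F.comp (ContinuousMap.addRight (θ : AddCircle (1 : ℝ)))
  set G' := G.comp (ContinuousMap.addRight (θ : AddCircle (1 : ℝ)))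
  have hF' (t : ℝ) : F' (t : AddCircle (1 : ℝ)) = (f (t + θ - 1) : ℂ) := by
    rw [hfp.sub_eq]
    exact hF (t + θ)
  have hG' (t : ℝ) : G' (t : AddCircle (1 : ℝ)) = (g (t + θ - 1) : ℂ) := by
    rw [hgp.sub_eq]
    exact hG (t + θ)
  have h_star_of_real {H : C(AddCircle (1 : ℝ), ℂ)} {h : ℝ → ℝ}
      (hH : ∀ t : ℝ, H (t : AddCircle (1 : ℝ)) = (h t : ℂ)) : star H = H := by
    ext x
    induction x using QuotientAddGroup.induction_on with
    | H t =>
      refine (congrArg star (hH t)).trans (Eq.trans ?_ (hH t).symm)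
      exact Complex.conj_ofReal _
  have hg_zero (t : ℝ) (h₀ : 0 ≤ t) (h₁ : t ≤ 1) : g t * g (t + θ - 1) = 0 := by
    rcases le_total t θ with h | h
    · rw [hg1 t ⟨h₀, h⟩, zero_mul]
    · rw [hg1 (t + θ - 1) ⟨by linarith, by linarith⟩, mul_zero]
  have h_linear (t : ℝ) (h₀ : 0 ≤ t) (h₁ : t ≤ 1) :
      g (t + θ - 1) * (f t + f (t + θ - 1)) = g (t + θ - 1) := by
    rcases le_total t (1 - θ) with h | h
    · have h_f := hf2 (t + θ) ⟨by linarith, by linarith⟩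
      rw [add_sub_cancel_right] at h_f
      rw [hfp.sub_eq, h_f]
      ring
    · rw [hg1 (t + θ - 1) ⟨by linarith, by linarith⟩, zero_mul]
  have h_quadratic (t : ℝ) (h₀ : 0 ≤ t) (h₁ : t ≤ 1) :
      g t * g t + f t * f t + g (t + θ - 1) * g (t + θ - 1) = f t := by
    rcases le_total t θ with h | h
    · rw [hg1 t ⟨h₀, h⟩]
      rcases le_total t (1 - θ) with h' | h'
      · have h_g := hg2 (t + θ) ⟨by linarith, by linarith⟩
        have h_f := hf2 (t + θ) ⟨by linarith, by linarith⟩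
        rw [add_sub_cancel_right] at h_f
        rw [hgp.sub_eq, ← sq (g (t + θ)), h_g, h_f]
        ring
      · rw [hg1 (t + θ - 1) ⟨by linarith, by linarith⟩, hf1 t ⟨h', h⟩]
        norm_num
    · rw [hg1 (t + θ - 1) ⟨by linarith, by linarith⟩]
      linear_combination hg2 t ⟨h, h₁⟩
  have h_disjoint_map : G * G' = 0 := by
    ext x
    obtain ⟨t, ⟨h₀, h₁⟩, rfl⟩ := AddCircle.exists_mem_Icc_coe_eq x
    rw [ContinuousMap.mul_apply, hG, hG', ContinuousMap.zero_apply]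
    exact_mod_cast hg_zero t h₀ h₁
  have h_linear_map : G' * (F + F') = G' := by
    ext x
    obtain ⟨t, ⟨h₀, h₁⟩, rfl⟩ := AddCircle.exists_mem_Icc_coe_eq x
    rw [ContinuousMap.mul_apply, ContinuousMap.add_apply, hG', hF, hF']
    exact_mod_cast h_linear t h₀ h₁
  have h_quadratic_map : G * G + F * F + G' * G' = F := by
    ext x
    obtain ⟨t, ⟨h₀, h₁⟩, rfl⟩ := AddCircle.exists_mem_Icc_coe_eq x
    simp only [ContinuousMap.mul_apply, ContinuousMap.add_apply, hG, hG', hF]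
    exact_mod_cast h_quadratic t h₀ h₁
  subst he₀
  refine ⟨?_, isIdempotentElem_mul_unitary_add_add_star_mul hu₂ (h_shift G) (h_shift F)
    ?_ ?_ ?_ ?_ ?_⟩
  · rw [star_add, star_add, star_mul, star_mul, star_star, ← map_star, ← map_star,
      h_star_of_real hF, h_star_of_real hG]
    abel
  · rw [← map_mul, mul_comm, h_disjoint_map, map_zero]
  · rw [← map_mul, h_disjoint_map, map_zero]
  · rw [← map_mul, ← map_mul, ← map_add, mul_comm F', ← mul_add, h_linear_map]
  · rw [← map_mul, ← map_mul, ← map_add, mul_comm F, ← mul_add, h_linear_map]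
  · rw [← map_mul, ← map_mul, ← map_mul, ← map_add, ← map_add, h_quadratic_map]
end

section
/- The trace of the Powers–Rieffel projection equals θ: if τ is a tracial state on A (a state with τ(ab) = τ(ba) for all a, b ∈ A) such that τ(u_1^m u_2^n) = 0 for every (m, n) ∈ ℤ² with (m, n) ≠ (0, 0), then τ(e_0) = θ, where e_0 := g(u_1)·u_2 + f(u_1) + u_2*·g(u_1). -/
open scoped ComplexOrder in
lemma LinearMap.continuous_of_nonneg_star_mul_self {B : Type*} [CStarAlgebra B]
    (φ : B →ₗ[ℂ] ℂ) (hφ : ∀ b, 0 ≤ φ (star b * b)) : Continuous φ := by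
  let _ := CStarAlgebra.spectralOrder B
  have := CStarAlgebra.spectralOrderedRing B
  have hpos : ∀ b, 0 ≤ b → 0 ≤ φ b := fun b hb ↦ by
    obtain ⟨c, rfl⟩ := CStarAlgebra.nonneg_iff_eq_star_mul_self.mp hb
    exact hφ c
  exact map_continuous (PositiveLinearMap.mk₀ φ hpos)

section Fourier

variable {T : ℝ}

lemma fourier_add_eq_mul (m n : ℤ) :
    fourier (m + n) = (fourier m * fourier n : C(AddCircle T, ℂ)) :=
  ContinuousMap.ext fun _ ↦ fourier_add

lemma fourier_neg_eq_star (n : ℤ) : fourier (-n) = star (fourier n : C(AddCircle T, ℂ)) :=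
  ContinuousMap.ext fun _ ↦ fourier_neg

lemma map_fourier_natCast {A : Type*} [Semiring A] [Algebra ℂ A]
    (Φ : C(AddCircle T, ℂ) →ₐ[ℂ] A) (n : ℕ) : Φ (fourier n) = Φ (fourier 1) ^ n := by
  rw [← map_pow]
  congr 1
  induction n with
  | zero => ext; simp
  | succ n ih => rw [Nat.cast_succ, fourier_add_eq_mul, ih, pow_succ]

lemma map_fourier_eq_zpow {A : Type*} [Ring A] [StarRing A] [Algebra ℂ A]
    (Φ : C(AddCircle T, ℂ) →⋆ₐ[ℂ] A) (u : unitary A) (hu : Φ (fourier 1) = u) (n : ℤ) :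
    Φ (fourier n) = ((u ^ n : unitary A) : A) := by
  have hnat (k : ℕ) : Φ (fourier k) = ((u ^ k : unitary A) : A) := by
    rw [SubmonoidClass.coe_pow, ← hu]
    exact map_fourier_natCast Φ.toAlgHom k
  obtain ⟨k, rfl | rfl⟩ := n.eq_nat_or_neg
  · rw [hnat, zpow_natCast]
  · rw [fourier_neg_eq_star, map_star, hnat, zpow_neg, zpow_natCast, ← Unitary.star_eq_inv,
      Unitary.coe_star]

variable [Fact (0 < T)]

lemma integral_fourier_eq_zero {n : ℤ} (hn : n ≠ 0) :
    ∫ x : AddCircle T, fourier n x ∂AddCircle.haarAddCircle = 0 :=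
  MeasureTheory.integral_eq_zero_of_add_right_eq_neg
    (fourier_add_half_inv_index hn (Fact.out : 0 < T))

/-- The Haar integral is the only continuous functional on `C(AddCircle T, ℂ)` that is `1` at `1`
and vanishes at the nonconstant Fourier monomials. -/
lemma eq_integral_haarAddCircle (φ : C(AddCircle T, ℂ) →ₗ[ℂ] ℂ) (hφ : Continuous φ)
    (h1 : φ 1 = 1) (hn : ∀ n : ℤ, n ≠ 0 → φ (fourier n) = 0) (F : C(AddCircle T, ℂ)) :
    φ F = ∫ x, F x ∂AddCircle.haarAddCircle := by
  have hint (G : C(AddCircle T, ℂ)) : MeasureTheory.Integrable G AddCircle.haarAddCircle :=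
    G.continuous.integrable_of_hasCompactSupport (HasCompactSupport.of_compactSpace G)
  have hcont : Continuous fun G : C(AddCircle T, ℂ) ↦ ∫ x, G x ∂AddCircle.haarAddCircle :=
    (MeasureTheory.continuous_integral.comp
      (ContinuousMap.toLp 1 AddCircle.haarAddCircle ℂ).continuous).congr fun G ↦
        MeasureTheory.integral_congr_ae (ContinuousMap.coeFn_toLp _ G)
  have hclosed := isClosed_eq hφ hcont
  have hF : F ∈ closure (Submodule.span ℂ (Set.range (fourier (T := T))) : Set _) := by
    rw [← Submodule.topologicalClosure_coe, span_fourier_closure_eq_top]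
    trivial
  refine hclosed.closure_subset_iff.mpr (fun G hG ↦ ?_) hF
  change φ G = _
  induction hG using Submodule.span_induction with
  | mem G hG =>
    obtain ⟨n, rfl⟩ := hG
    obtain rfl | h := eq_or_ne n 0
    · have : fourier 0 = (1 : C(AddCircle T, ℂ)) := by ext; simp
      simp [this, h1]
    · rw [hn n h, integral_fourier_eq_zero h]
  | zero => simp
  | add G H _ _ hG hH =>
    simp only [map_add, ContinuousMap.add_apply, hG, hH]
    rw [MeasureTheory.integral_add (hint G) (hint H)]
  | smul c G _ hG =>
    simp only [map_smul, ContinuousMap.smul_apply, hG]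
    rw [MeasureTheory.integral_smul]

end Fourier

/-- A tracial functional vanishes at every element which commutes with a unitary up to a scalar
other than `1`. -/
lemma trace_eq_zero_of_mul_eq_smul_mul {𝕜 A : Type*} [Field 𝕜] [Ring A] [StarRing A] [Algebra 𝕜 A]
    (τ : A →ₗ[𝕜] 𝕜) (htr : ∀ a b, τ (a * b) = τ (b * a)) {u x : A} (hu : u ∈ unitary A)
    {c : 𝕜} (hc : c ≠ 1) (h : u * x = c • (x * u)) : τ x = 0 := by
  have key : τ x = c * τ x := by
    calc τ x = τ (star u * (u * x)) := by
          rw [← mul_assoc, Unitary.star_mul_self_of_mem hu, one_mul]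
      _ = c * τ x := by
          rw [h, mul_smul_comm, map_smul, smul_eq_mul, htr, mul_assoc,
            Unitary.mul_star_self_of_mem hu, mul_one]
  have : (1 - c) * τ x = 0 := by linear_combination key
  exact (mul_eq_zero.mp this).resolve_left (sub_ne_zero.mpr hc.symm)

lemma exp_two_pi_I_mul_ne_one {θ : ℝ} (hθ : Irrational θ) :
    Complex.exp (2 * (Real.pi : ℂ) * Complex.I * (θ : ℂ)) ≠ 1 := by
  rw [Ne, Complex.exp_eq_one_iff]
  rintro ⟨n, hn⟩
  refine hθ.ne_int n ?_
  rw [mul_comm] at hn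
  exact_mod_cast mul_right_cancel₀ Complex.two_pi_I_ne_zero hn

lemma integral_eq_of_eq_one_sub {θ : ℝ} {f : ℝ → ℝ} (hθ : 1 / 2 ≤ θ) (hθ' : θ ≤ 1)
    (hf : Continuous f) (hf1 : ∀ s ∈ Set.Icc (1 - θ) θ, f s = 1)
    (hf2 : ∀ s ∈ Set.Icc θ 1, f s = 1 - f (s - θ)) : ∫ s in (0 : ℝ)..1, f s = θ := by
  have hi (a b : ℝ) : IntervalIntegrable f MeasureTheory.volume a b := hf.intervalIntegrable a b
  have hmid : ∫ s in (1 - θ)..θ, f s = 2 * θ - 1 := by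
    rw [intervalIntegral.integral_congr (g := fun _ ↦ (1 : ℝ))]
    · simp only [intervalIntegral.integral_const, smul_eq_mul]; ring
    · rw [Set.uIcc_of_le (by linarith)]; exact hf1
  have hlast : ∫ s in θ..1, f s = (1 - θ) - ∫ s in (0 : ℝ)..(1 - θ), f s := by
    rw [intervalIntegral.integral_congr (g := fun s ↦ 1 - f (s - θ)),
      intervalIntegral.integral_sub intervalIntegrable_const
        (Continuous.intervalIntegrable (by fun_prop) _ _),
      intervalIntegral.integral_comp_sub_right]
    · simp
    · rw [Set.uIcc_of_le hθ']; exact hf2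
  rw [← intervalIntegral.integral_add_adjacent_intervals (hi 0 (1 - θ)) (hi _ _),
    ← intervalIntegral.integral_add_adjacent_intervals (hi (1 - θ) θ) (hi _ _), hmid, hlast]
  ring


/-- the trace of the Powers–Rieffel projection
`e₀ = g(u₁)u₂ + f(u₁) + u₂* g(u₁)` equals `θ`, for any tracial state `τ` with
`τ(u₁^m u₂^n) = 0` for `(m, n) ≠ (0, 0)`. -/
theorem powers_rieffel_projection_trace
    (θ : ℝ) (hθ : θ ∈ Set.Ioo (1 / 2 : ℝ) 1) (hirr : Irrational θ)
    {A : Type} [NormedRing A] [StarRing A] [CStarRing A]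
    [NormedAlgebra ℂ A] [CompleteSpace A] [StarModule ℂ A]
    (u₁ u₂ : A) (hu₁ : u₁ ∈ unitary A) (hu₂ : u₂ ∈ unitary A)
    (hcomm : u₁ * u₂ = Complex.exp (2 * (Real.pi : ℂ) * Complex.I * (θ : ℂ)) • (u₂ * u₁))
    (f g : ℝ → ℝ)
    (hf : Continuous f) (hfp : Function.Periodic f 1)
    (hg : Continuous g) (hgp : Function.Periodic g 1)
    (hf1 : ∀ s ∈ Set.Icc (1 - θ) θ, f s = 1)
    (hf2 : ∀ s ∈ Set.Icc θ 1, f s = 1 - f (s - θ))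
    (hg1 : ∀ s ∈ Set.Icc (0 : ℝ) θ, g s = 0)
    (hg2 : ∀ s ∈ Set.Icc θ 1, g s ^ 2 = f s - f s ^ 2)
    (F G E : C(AddCircle (1 : ℝ), ℂ))
    (hF : ∀ t : ℝ, F (t : AddCircle (1 : ℝ)) = (f t : ℂ))
    (hG : ∀ t : ℝ, G (t : AddCircle (1 : ℝ)) = (g t : ℂ))
    (hE : ∀ t : ℝ, E (t : AddCircle (1 : ℝ))
        = Complex.exp (2 * (Real.pi : ℂ) * Complex.I * (t : ℂ)))
    (Φ : C(AddCircle (1 : ℝ), ℂ) →⋆ₐ[ℂ] A) (hΦ : Φ E = u₁)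
    (e₀ : A) (he₀ : e₀ = Φ G * u₂ + Φ F + star u₂ * Φ G)
    (τ : A →ₗ[ℂ] ℂ)
    (hτ1 : τ 1 = 1)
    (hpos : ∀ a : A, 0 ≤ (τ (star a * a)).re ∧ (τ (star a * a)).im = 0)
    (htr : ∀ a b : A, τ (a * b) = τ (b * a))
    (hvanish : ∀ m n : ℤ, ¬(m = 0 ∧ n = 0) →
      τ ((((⟨u₁, hu₁⟩ : unitary A) ^ m : unitary A) : A)
          * (((⟨u₂, hu₂⟩ : unitary A) ^ n : unitary A) : A)) = 0) :
    τ e₀ = (θ : ℂ) := by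
  have hE' : E = fourier 1 := by
    ext x
    induction x using QuotientAddGroup.induction_on with
    | H t => rw [hE, fourier_coe_apply]; simp
  have hfour : Φ (fourier 1) = u₁ := hE' ▸ hΦ
  have hc := exp_two_pi_I_mul_ne_one hirr
  set c := Complex.exp (2 * (Real.pi : ℂ) * Complex.I * (θ : ℂ))
  have hc0 : c ≠ 0 := Complex.exp_ne_zero _
  have hcommG : u₁ * Φ G = Φ G * u₁ := by rw [← hΦ, ← map_mul, ← map_mul, mul_comm]
  have hcomm' : u₁ * star u₂ = c⁻¹ • (star u₂ * u₁) := by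
    rw [eq_inv_smul_iff₀ hc0]
    calc c • (u₁ * star u₂) = star u₂ * (c • (u₂ * u₁)) * star u₂ := by
          rw [mul_smul_comm, ← mul_assoc, Unitary.star_mul_self_of_mem hu₂, one_mul,
            smul_mul_assoc]
      _ = star u₂ * u₁ := by
          rw [← hcomm, mul_assoc, mul_assoc, Unitary.mul_star_self_of_mem hu₂, mul_one]
  have hleft : τ (Φ G * u₂) = 0 :=
    trace_eq_zero_of_mul_eq_smul_mul τ htr hu₁ hc <| by
      rw [← mul_assoc, hcommG, mul_assoc, hcomm, mul_smul_comm, mul_assoc]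
  have hright : τ (star u₂ * Φ G) = 0 :=
    trace_eq_zero_of_mul_eq_smul_mul τ htr hu₁ (inv_ne_one.mpr hc) <| by
      rw [← mul_assoc, hcomm', smul_mul_assoc, mul_assoc, hcommG, mul_assoc]
  have hcont : Continuous (τ ∘ₗ Φ.toAlgHom.toLinearMap) := by
    refine LinearMap.continuous_of_nonneg_star_mul_self _ fun b ↦ ?_
    have h : (τ ∘ₗ Φ.toAlgHom.toLinearMap) (star b * b) = τ (star (Φ b) * Φ b) := by
      rw [← map_star, ← map_mul]; rfl
    rw [h, Complex.nonneg_iff]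
    exact ⟨(hpos _).1, (hpos _).2.symm⟩
  have hmean : τ (Φ F) = (θ : ℂ) := by
    refine (eq_integral_haarAddCircle _ hcont (by simp [hτ1]) (fun n hn ↦ ?_) F).trans ?_
    · have h := hvanish n 0 fun h ↦ hn h.1
      rw [zpow_zero, OneMemClass.coe_one, mul_one, ← map_fourier_eq_zpow Φ ⟨u₁, hu₁⟩ hfour] at h
      exact h
    · rw [AddCircle.integral_haarAddCircle, inv_one, one_smul,
        ← AddCircle.intervalIntegral_preimage 1 0, zero_add]
      simp_rw [hF]
      rw [intervalIntegral.integral_ofReal,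
        integral_eq_of_eq_one_sub hθ.1.le hθ.2.le hf hf1 hf2]
  rw [he₀, map_add, map_add, hleft, hright, hmean, zero_add, add_zero]
end

section
/- Every endomorphism of the Schwartz module over the noncommutative torus is a finite difference operator: if T : S(ℝ) → S(ℝ) is a continuous linear map satisfying T ∘ U = U ∘ T and T ∘ V = V ∘ T, then there exists a family (φ_n)_{n ∈ ℤ} of C^∞ functions ℝ → ℂ, each θ-periodic (φ_n(s+θ) = φ_n(s)), with rapidly decaying derivatives in the sense that for all k, m ∈ ℕ one has sup_{n ∈ ℤ, s ∈ ℝ} (1+|n|)^m |φ_n^{(k)}(s)| < ∞, such that (TF)(s) = Σ_{n ∈ ℤ} φ_n(s)·F(s−n) for every F ∈ S(ℝ) and s ∈ ℝ. Conversely, every such family of functions defines a continuous linear map T : S(ℝ) → S(ℝ) commuting with U and V by this formula. -/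
/-- A family `(φₙ)_{n ∈ ℤ}` of smooth `θ`-periodic coefficient functions all of whose
derivatives decay rapidly in `n`, uniformly in `s`. -/
def IsFiniteDifferenceFamily (θ : ℝ) (φ : ℤ → ℝ → ℂ) : Prop :=
  (∀ n : ℤ, ContDiff ℝ (⊤ : ℕ∞) (φ n)) ∧
  (∀ (n : ℤ) (s : ℝ), φ n (s + θ) = φ n s) ∧
  (∀ k m : ℕ, ∃ C : ℝ, ∀ (n : ℤ) (s : ℝ),
    (1 + |(n : ℝ)|) ^ m * ‖iteratedDeriv k (φ n) s‖ ≤ C)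

open scoped ContDiff Topology

/-- The weighted averages of a smooth function over the segments `[0, x]` depend
differentiably on `x`. -/
lemma hasDerivAt_integral_pow_mul_comp_mul {f : ℝ → ℂ} (hf : ContDiff ℝ ∞ f) (k : ℕ) (x : ℝ) :
    HasDerivAt (fun x : ℝ => ∫ t in (0 : ℝ)..1, (t : ℂ) ^ k * f (t * x))
      (∫ t in (0 : ℝ)..1, (t : ℂ) ^ (k + 1) * deriv f (t * x)) x := by
  have hc := hf.continuous
  have hd : Continuous (deriv f) := hf.continuous_deriv (by simp)
  obtain ⟨C, hC⟩ := (isCompact_Icc (a := -(|x| + 1)) (b := |x| + 1)).exists_bound_of_continuousOn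
    hd.continuousOn
  refine (intervalIntegral.hasDerivAt_integral_of_dominated_loc_of_deriv_le
    (F := fun x t : ℝ => (t : ℂ) ^ k * f (t * x))
    (F' := fun x t : ℝ => (t : ℂ) ^ (k + 1) * deriv f (t * x)) (bound := fun _ => C)
    (Metric.ball_mem_nhds x one_pos) (.of_forall fun y => ?_) ?_ ?_ (.of_forall ?_) ?_
    (.of_forall ?_)).2
  · exact Continuous.aestronglyMeasurable (by fun_prop)
  · exact Continuous.intervalIntegrable (by fun_prop) _ _
  · exact Continuous.aestronglyMeasurable (by fun_prop)
  · intro t ht y hy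
    rw [Set.uIoc_of_le zero_le_one] at ht
    have hty : |t * y| ≤ |x| + 1 := by
      rw [Metric.mem_ball, Real.dist_eq] at hy
      have h1 : |y| ≤ |x| + 1 := by
        have := abs_sub_abs_le_abs_sub y x
        linarith
      rw [abs_mul, abs_of_pos ht.1]
      nlinarith [abs_nonneg y, ht.1, ht.2]
    have h2 := hC (t * y) (abs_le.mp hty)
    have h3 : |t| ^ (k + 1) ≤ 1 := pow_le_one₀ (abs_nonneg t) (by rw [abs_of_pos ht.1]; exact ht.2)
    rw [norm_mul, norm_pow, Complex.norm_real, Real.norm_eq_abs]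
    nlinarith [norm_nonneg (deriv f (t * y)), pow_nonneg (abs_nonneg t) (k + 1)]
  · exact intervalIntegrable_const
  · intro t _ y _
    have h1 : HasDerivAt f (deriv f (t * y)) (t * y) :=
      (hf.differentiable (by simp)).differentiableAt.hasDerivAt
    have h2 : HasDerivAt (fun y : ℝ => t * y) t y := by
      simpa using (hasDerivAt_id y).const_mul t
    refine ((h1.scomp y h2).const_mul ((t : ℂ) ^ k)).congr_deriv ?_
    rw [Complex.real_smul]
    ring

lemma contDiff_integral_pow_mul_comp_mul {f : ℝ → ℂ} (hf : ContDiff ℝ ∞ f) (k : ℕ) :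
    ContDiff ℝ ∞ (fun x : ℝ => ∫ t in (0 : ℝ)..1, (t : ℂ) ^ k * f (t * x)) := by
  refine contDiff_infty.2 fun n => ?_
  induction n generalizing f k with
  | zero =>
    exact contDiff_zero.2 (continuous_iff_continuousAt.2 fun x =>
      (hasDerivAt_integral_pow_mul_comp_mul hf k x).continuousAt)
  | succ n ih =>
    have h := hasDerivAt_integral_pow_mul_comp_mul hf k
    have hn : ((n + 1 : ℕ) : WithTop ℕ∞) = (n : WithTop ℕ∞) + 1 := by norm_cast
    rw [hn, contDiff_succ_iff_deriv]
    refine ⟨fun x => (h x).differentiableAt, fun hω => by simp at hω, ?_⟩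
    rw [funext fun x => (h x).deriv]
    exact ih (contDiff_infty_iff_deriv.1 hf).2 (k + 1)

/-- Hadamard's lemma in dimension one. -/
lemma exists_contDiff_eq_add_sub_mul {f : ℝ → ℂ} (hf : ContDiff ℝ ∞ f) (p : ℝ) :
    ∃ h : ℝ → ℂ, ContDiff ℝ ∞ h ∧ h p = deriv f p ∧
      ∀ x, f x = f p + ((x - p : ℝ) : ℂ) * h x := by
  have hg : ContDiff ℝ ∞ (fun y => deriv f (p + y)) :=
    (contDiff_infty_iff_deriv.1 hf).2.comp (contDiff_const.add contDiff_id)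
  have hd : Continuous (deriv f) := hf.continuous_deriv (by simp)
  refine ⟨fun x => ∫ t in (0 : ℝ)..1, (t : ℂ) ^ 0 * deriv f (p + t * (x - p)),
    (contDiff_integral_pow_mul_comp_mul hg 0).comp (contDiff_id.sub contDiff_const), by simp,
    fun x => ?_⟩
  have key : ∫ t in (0 : ℝ)..1, ((x - p : ℝ) : ℂ) * deriv f (p + t * (x - p)) =
      f (p + 1 * (x - p)) - f (p + 0 * (x - p)) := by
    refine intervalIntegral.integral_eq_sub_of_hasDerivAt
      (f := fun t => f (p + t * (x - p))) (fun t _ => ?_)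
      (Continuous.intervalIntegrable (by fun_prop) _ _)
    have h1 : HasDerivAt f (deriv f (p + t * (x - p))) (p + t * (x - p)) :=
      (hf.differentiable (by simp)).differentiableAt.hasDerivAt
    have h2 : HasDerivAt (fun t : ℝ => p + t * (x - p)) (x - p) t := by
      simpa using ((hasDerivAt_id t).mul_const (x - p)).const_add p
    exact (h1.scomp t h2).congr_deriv (Complex.real_smul ..)
  rw [intervalIntegral.integral_const_mul] at key
  simp only [pow_zero, one_mul, zero_mul, add_zero, add_sub_cancel] at key ⊢
  rw [key]
  ring

/-- A smooth function vanishing on the zero set of a smooth function `d` with only simple zeros is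
a smooth multiple of `d`. -/
lemma exists_contDiff_mul_eq {F d : ℝ → ℂ} (hF : ContDiff ℝ ∞ F) (hd : ContDiff ℝ ∞ d)
    (hzero : ∀ x, d x = 0 → F x = 0) (hsimple : ∀ x, d x = 0 → deriv d x ≠ 0) :
    ∃ G : ℝ → ℂ, ContDiff ℝ ∞ G ∧ (∀ x, F x = d x * G x) ∧
      Function.support G ⊆ tsupport F := by
  classical
  refine ⟨fun x => if d x = 0 then deriv F x / deriv d x else F x / d x, ?_, fun x => ?_,
    fun x hx => ?_⟩
  · refine contDiff_iff_contDiffAt.2 fun p => ?_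
    by_cases hp : d p = 0
    · obtain ⟨H, hH, hHp, hHF⟩ := exists_contDiff_eq_add_sub_mul hF p
      obtain ⟨E, hE, hEp, hEd⟩ := exists_contDiff_eq_add_sub_mul hd p
      have hEp0 : E p ≠ 0 := hEp ▸ hsimple p hp
      refine (hH.contDiffAt.mul (hE.contDiffAt.inv hEp0)).congr_of_eventuallyEq ?_
      filter_upwards [hE.continuous.continuousAt.eventually_ne hEp0] with x hx
      simp only [hzero p hp, zero_add] at hHF
      simp only [hp, zero_add] at hEd
      rcases eq_or_ne x p with rfl | hxp
      · simp [hp, hHp, hEp, div_eq_mul_inv]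
      · have hxp' : ((x - p : ℝ) : ℂ) ≠ 0 := Complex.ofReal_ne_zero.2 (sub_ne_zero.2 hxp)
        rw [if_neg (by rw [hEd]; exact mul_ne_zero hxp' hx), hHF, hEd,
          mul_div_mul_left _ _ hxp', div_eq_mul_inv, Pi.inv_apply]
    · refine (hF.contDiffAt.mul (hd.contDiffAt.inv hp)).congr_of_eventuallyEq ?_
      filter_upwards [hd.continuous.continuousAt.eventually_ne hp] with x hx
      rw [if_neg hx, div_eq_mul_inv, Pi.inv_apply]
  · by_cases hx : d x = 0
    · simp [hx, hzero x hx]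
    · simp [hx, mul_div_cancel₀]
  · by_contra hxF
    have h1 : F x = 0 := image_eq_zero_of_notMem_tsupport hxF
    have h2 : deriv F x = 0 := by
      by_contra h
      exact hxF (support_deriv_subset h)
    simp [h1, h2] at hx

/-- A smooth compactly supported function equal to `1` near `0` has a complement `1 - κ` all of
whose derivatives are at most linear. -/
lemma exists_norm_iteratedDeriv_one_sub_le {κ : ℝ → ℂ} (hκ : ContDiff ℝ ∞ κ)
    (hsupp : HasCompactSupport κ) (hone : κ =ᶠ[𝓝 0] 1) (i : ℕ) :
    ∃ C : ℝ, 0 ≤ C ∧ ∀ y, ‖iteratedDeriv i (fun y => 1 - κ y) y‖ ≤ C * |y| := by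
  have hbdd : ∃ B, ∀ y, ‖iteratedDeriv i (fun y => 1 - κ y) y‖ ≤ B := by
    obtain ⟨B, hB⟩ := (hsupp.toSchwartzMap hκ).decay' 0 i
    simp only [pow_zero, one_mul, norm_iteratedFDeriv_eq_norm_iteratedDeriv] at hB
    rcases Nat.eq_zero_or_pos i with rfl | hi
    · refine ⟨1 + B, fun y => ?_⟩
      simp only [iteratedDeriv_zero] at hB ⊢
      exact (norm_sub_le _ _).trans <| add_le_add norm_one.le (hB y)
    · refine ⟨B, fun y => ?_⟩
      simp only [iteratedDeriv_const_sub hi, iteratedDeriv_neg, norm_neg]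
      exact hB y
  obtain ⟨B, hB⟩ := hbdd
  obtain ⟨ε, hε, hball⟩ := Metric.eventually_nhds_iff_ball.1 hone
  have hB0 : 0 ≤ B := (norm_nonneg _).trans (hB 0)
  refine ⟨B / ε, by positivity, fun y => ?_⟩
  by_cases hy : |y| < ε
  · have h0 : (fun y => 1 - κ y) =ᶠ[𝓝 y] fun _ => 0 := by
      filter_upwards [Metric.isOpen_ball.mem_nhds (show y ∈ Metric.ball 0 ε by simpa using hy)]
        with z hz
      simp [hball z hz]
    rw [h0.iteratedDeriv_eq, iteratedDeriv_fun_const_zero, norm_zero]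
    positivity
  · rw [div_mul_eq_mul_div, le_div_iff₀ hε]
    exact mul_le_mul (hB y) (not_lt.1 hy) hε.le hB0

/-- Compactly supported functions are dense in the Schwartz space on the line. -/
lemma SchwartzMap.dense_hasCompactSupport :
    Dense {F : SchwartzMap ℝ ℂ | HasCompactSupport F} := by
  let b : ContDiffBump (0 : ℝ) := ⟨1, 2, one_pos, one_lt_two⟩
  let κ : ℝ → ℂ := fun x => (b x : ℂ)
  have hκ : ContDiff ℝ ∞ κ := Complex.ofRealCLM.contDiff.comp b.contDiff
  have hκs : HasCompactSupport κ := b.hasCompactSupport.comp_left Complex.ofReal_zero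
  have hκ1 : κ =ᶠ[𝓝 0] 1 := by
    filter_upwards [b.eventuallyEq_one] with x hx
    simp [κ, hx]
  intro F
  let c : ℕ → ℝ := fun N => ((N : ℝ) + 1)⁻¹
  have hc : ∀ N, 0 < c N := fun N => by positivity
  have hc1 : ∀ N, c N ≤ 1 := fun N => inv_le_one_of_one_le₀ (by linarith [N.cast_nonneg (α := ℝ)])
  have hcs : ∀ N, ContDiff ℝ ∞ (fun x => κ (c N * x)) :=
    fun N => hκ.comp (contDiff_const.mul contDiff_id)
  have hsupp : ∀ N, HasCompactSupport (fun x => κ (c N * x) * F x) := fun N =>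
    (hκs.comp_homeomorph (Homeomorph.mulLeft₀ (c N) (hc N).ne')).mul_right
  let G : ℕ → SchwartzMap ℝ ℂ := fun N => (hsupp N).toSchwartzMap ((hcs N).mul (F.smooth ⊤))
  refine mem_closure_of_tendsto (f := G) (b := Filter.atTop) ?_ (.of_forall fun N => hsupp N)
  rw [(schwartz_withSeminorms ℂ ℝ ℂ).tendsto_nhds]
  rintro ⟨k, n⟩ ε hε
  choose C hC0 hC using exists_norm_iteratedDeriv_one_sub_le hκ hκs hκ1
  let S : ℝ := ∑ i ∈ Finset.range (n + 1),
    (n.choose i : ℝ) * C i * SchwartzMap.seminorm ℂ (k + 1) (n - i) F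
  have hS : 0 ≤ S := Finset.sum_nonneg fun i _ =>
    mul_nonneg (mul_nonneg (Nat.cast_nonneg _) (hC0 i)) (apply_nonneg _ _)
  have hbound : ∀ N, SchwartzMap.seminorm ℂ k n (G N - F) ≤ c N * S := by
    intro N
    have hg : ContDiff ℝ ∞ (fun x => 1 - κ (c N * x)) := contDiff_const.sub (hcs N)
    have hgi : ∀ i x, ‖iteratedFDeriv ℝ i (fun x => 1 - κ (c N * x)) x‖ ≤ C i * (c N * |x|) := by
      intro i x
      rw [norm_iteratedFDeriv_eq_norm_iteratedDeriv,
        iteratedDeriv_comp_const_smul (f := fun y => 1 - κ y)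
          ((contDiff_const.sub hκ).of_le (mod_cast le_top)) (c N), norm_smul]
      have h1 : ‖c N ^ i‖ ≤ 1 := by
        rw [norm_pow, Real.norm_of_nonneg (hc N).le]
        exact pow_le_one₀ (hc N).le (hc1 N)
      have h2 := hC i (c N * x)
      rw [abs_mul, abs_of_pos (hc N)] at h2
      exact (mul_le_of_le_one_left (norm_nonneg _) h1).trans h2
    have hneg : SchwartzMap.seminorm ℂ k n (G N - F) = SchwartzMap.seminorm ℂ k n (F - G N) :=
      map_sub_rev _ _ _
    rw [hneg]
    refine SchwartzMap.seminorm_le_bound ℂ k n _ (mul_nonneg (hc N).le hS) fun x => ?_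
    have hfun : (⇑(F - G N) : ℝ → ℂ) = fun x => (1 - κ (c N * x)) * F x := by
      ext x
      change F x - κ (c N * x) * F x = _
      ring
    rw [hfun]
    have hmul := norm_iteratedFDeriv_mul_le (n := n) hg (F.smooth ⊤) x (mod_cast le_top)
    refine (mul_le_mul_of_nonneg_left hmul (by positivity)).trans ?_
    rw [Finset.mul_sum, Finset.mul_sum]
    refine Finset.sum_le_sum fun i _ => ?_
    have hF := SchwartzMap.le_seminorm ℂ (k + 1) (n - i) F x
    calc ‖x‖ ^ k * ((n.choose i : ℝ) * ‖iteratedFDeriv ℝ i (fun x => 1 - κ (c N * x)) x‖ *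
          ‖iteratedFDeriv ℝ (n - i) F x‖)
        ≤ ‖x‖ ^ k * ((n.choose i : ℝ) * (C i * (c N * |x|)) *
          ‖iteratedFDeriv ℝ (n - i) F x‖) := by gcongr; exact hgi i x
      _ = c N * ((n.choose i : ℝ) * C i * (‖x‖ ^ (k + 1) * ‖iteratedFDeriv ℝ (n - i) F x‖)) := by
          rw [Real.norm_eq_abs]; ring
      _ ≤ _ := by
          have := hC0 i
          have := hc N
          gcongr
  have hlim : Filter.Tendsto (fun N => c N * S) Filter.atTop (𝓝 0) := by
    simpa [c] using (tendsto_one_div_add_atTop_nhds_zero_nat (𝕜 := ℝ)).mul_const S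
  filter_upwards [hlim.eventually_lt_const hε] with N hN
  exact (hbound N).trans_lt hN

lemma summable_int_one_add_abs_pow_neg_two : Summable fun n : ℤ => ((1 + |(n : ℝ)|) ^ 2)⁻¹ := by
  have h : Summable fun n : ℕ => ((1 + |((n : ℤ) : ℝ)|) ^ 2)⁻¹ := by
    have := (summable_nat_add_iff 1).2 (Real.summable_nat_pow_inv.2 one_lt_two)
    refine this.congr fun n => ?_
    simp [add_comm]
  exact Summable.of_nat_of_neg h (by simpa using h)

lemma one_add_norm_le_mul (s a : ℝ) : 1 + ‖s‖ ≤ (1 + |a|) * (1 + ‖s - a‖) := by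
  have h := norm_add_le (s - a) a
  rw [sub_add_cancel, Real.norm_eq_abs a] at h
  nlinarith [abs_nonneg a, norm_nonneg (s - a)]

namespace IsFiniteDifferenceFamily

variable {θ : ℝ} {φ : ℤ → ℝ → ℂ}

lemma contDiff_term (hφ : IsFiniteDifferenceFamily θ φ) (F : SchwartzMap ℝ ℂ) (n : ℤ) :
    ContDiff ℝ ∞ fun s => φ n s * F (s - (n : ℝ)) :=
  (hφ.1 n).mul ((F.smooth ⊤).comp (contDiff_id.sub contDiff_const))

lemma exists_norm_iteratedFDeriv_term_le (hφ : IsFiniteDifferenceFamily θ φ) (k l : ℕ) :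
    ∃ C : ℝ, 0 ≤ C ∧ ∀ (F : SchwartzMap ℝ ℂ) (n : ℤ) (s : ℝ),
      (1 + ‖s‖) ^ k * ‖iteratedFDeriv ℝ l (fun s => φ n s * F (s - (n : ℝ))) s‖ ≤
        C * (Finset.Iic (k, l)).sup (schwartzSeminormFamily ℂ ℝ ℂ) F *
          ((1 + |(n : ℝ)|) ^ 2)⁻¹ := by
  choose C hC using fun i => hφ.2.2 i (k + 2)
  have hC0 : ∀ i, 0 ≤ C i := fun i => le_trans (by positivity) (hC i 0 0)
  refine ⟨∑ i ∈ Finset.range (l + 1), (l.choose i : ℝ) * C i * 2 ^ k,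
    Finset.sum_nonneg fun i _ => by have := hC0 i; positivity, fun F n s => ?_⟩
  set P := (Finset.Iic (k, l)).sup (schwartzSeminormFamily ℂ ℝ ℂ) F
  have hn : (0 : ℝ) < 1 + |(n : ℝ)| := by positivity
  have hmul := norm_iteratedFDeriv_mul_le (n := l) (hφ.1 n)
    ((F.smooth ⊤).comp ((contDiff_id (E := ℝ)).sub (contDiff_const (c := (n : ℝ))))) s
    (mod_cast le_top)
  refine (mul_le_mul_of_nonneg_left hmul (by positivity)).trans ?_
  rw [Finset.mul_sum, Finset.sum_mul, Finset.sum_mul]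
  refine Finset.sum_le_sum fun i _ => ?_
  have hF : (1 + ‖s - n‖) ^ k * ‖iteratedFDeriv ℝ (l - i) (fun s => F (s - (n : ℝ))) s‖ ≤
      2 ^ k * P := by
    rw [iteratedFDeriv_comp_sub]
    exact SchwartzMap.one_add_le_sup_seminorm_apply (m := (k, l)) le_rfl (Nat.sub_le l i) F _
  have hφi := hC i n s
  rw [← norm_iteratedFDeriv_eq_norm_iteratedDeriv] at hφi
  have hs : (1 + ‖s‖) ^ k ≤ (1 + |(n : ℝ)|) ^ k * (1 + ‖s - n‖) ^ k := by
    rw [← mul_pow]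
    exact pow_le_pow_left₀ (by positivity) (one_add_norm_le_mul s n) k
  rw [← div_eq_mul_inv, le_div_iff₀ (by positivity)]
  calc (1 + ‖s‖) ^ k * ((l.choose i : ℝ) * ‖iteratedFDeriv ℝ i (φ n) s‖ *
        ‖iteratedFDeriv ℝ (l - i) (fun s => F (s - (n : ℝ))) s‖) * (1 + |(n : ℝ)|) ^ 2
      ≤ ((1 + |(n : ℝ)|) ^ k * (1 + ‖s - n‖) ^ k) *
        ((l.choose i : ℝ) * ‖iteratedFDeriv ℝ i (φ n) s‖ *
        ‖iteratedFDeriv ℝ (l - i) (fun s => F (s - (n : ℝ))) s‖) * (1 + |(n : ℝ)|) ^ 2 := by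
        gcongr
    _ = (l.choose i : ℝ) * ((1 + |(n : ℝ)|) ^ (k + 2) * ‖iteratedFDeriv ℝ i (φ n) s‖) *
        ((1 + ‖s - n‖) ^ k * ‖iteratedFDeriv ℝ (l - i) (fun s => F (s - (n : ℝ))) s‖) := by
        ring
    _ ≤ (l.choose i : ℝ) * C i * (2 ^ k * P) := by
        have := hC0 i
        gcongr
    _ = _ := by ring

lemma exists_summable_bound (hφ : IsFiniteDifferenceFamily θ φ) (F : SchwartzMap ℝ ℂ) :
    ∃ v : ℕ → ℤ → ℝ, (∀ l, Summable (v l)) ∧ ∀ (l : ℕ) (n : ℤ) (s : ℝ),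
      ‖iteratedFDeriv ℝ l (fun s => φ n s * F (s - (n : ℝ))) s‖ ≤ v l n := by
  choose C _ hC using hφ.exists_norm_iteratedFDeriv_term_le 0
  exact ⟨_, fun l => summable_int_one_add_abs_pow_neg_two.mul_left _,
    fun l n s => by simpa only [pow_zero, one_mul] using hC l F n s⟩

lemma summable_term (hφ : IsFiniteDifferenceFamily θ φ) (F : SchwartzMap ℝ ℂ) (s : ℝ) :
    Summable fun n : ℤ => φ n s * F (s - (n : ℝ)) := by
  obtain ⟨v, hv, hle⟩ := hφ.exists_summable_bound F
  exact .of_norm_bounded (hv 0) fun n => by simpa using hle 0 n s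

/-- The finite difference operator `F ↦ ∑ₙ φₙ F(· - n)` on the Schwartz space. -/
noncomputable def toCLM (hφ : IsFiniteDifferenceFamily θ φ) :
    SchwartzMap ℝ ℂ →L[ℂ] SchwartzMap ℝ ℂ :=
  SchwartzMap.mkCLM (fun F s => ∑' n : ℤ, φ n s * F (s - (n : ℝ)))
    (fun F G s => by
      rw [← (hφ.summable_term F s).tsum_add (hφ.summable_term G s)]
      exact tsum_congr fun n => by rw [add_apply, mul_add])
    (fun a F s => by
      rw [RingHom.id_apply, smul_eq_mul, ← tsum_mul_left]
      exact tsum_congr fun n => by rw [smul_apply, smul_eq_mul, mul_left_comm])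
    (fun F => by
      obtain ⟨v, hv, hle⟩ := hφ.exists_summable_bound F
      exact contDiff_tsum (N := ⊤) (hφ.contDiff_term F) (fun l _ => hv l)
        fun l n s _ => hle l n s)
    (by
      rintro ⟨k, l⟩
      obtain ⟨C, hC0, hC⟩ := hφ.exists_norm_iteratedFDeriv_term_le k l
      refine ⟨Finset.Iic (k, l), C * ∑' n : ℤ, ((1 + |(n : ℝ)|) ^ 2)⁻¹,
        mul_nonneg hC0 (tsum_nonneg fun n => by positivity), fun F s => ?_⟩
      obtain ⟨v, hv, hle⟩ := hφ.exists_summable_bound F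
      rw [iteratedFDeriv_tsum_apply (N := ⊤) (hφ.contDiff_term F) (fun l _ => hv l)
        (fun l n s _ => hle l n s) le_top]
      have hsum : Summable fun n : ℤ =>
          ‖iteratedFDeriv ℝ l (fun s => φ n s * F (s - (n : ℝ))) s‖ :=
        .of_nonneg_of_le (fun _ => norm_nonneg _) (fun n => hle l n s) (hv l)
      calc ‖s‖ ^ k * ‖∑' n : ℤ, iteratedFDeriv ℝ l (fun s => φ n s * F (s - (n : ℝ))) s‖
          ≤ (1 + ‖s‖) ^ k *
            ∑' n : ℤ, ‖iteratedFDeriv ℝ l (fun s => φ n s * F (s - (n : ℝ))) s‖ := by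
            gcongr
            · linarith
            · exact norm_tsum_le_tsum_norm hsum
        _ = ∑' n : ℤ, (1 + ‖s‖) ^ k *
            ‖iteratedFDeriv ℝ l (fun s => φ n s * F (s - (n : ℝ))) s‖ := tsum_mul_left.symm
        _ ≤ ∑' n : ℤ, C * (Finset.Iic (k, l)).sup (schwartzSeminormFamily ℂ ℝ ℂ) F *
            ((1 + |(n : ℝ)|) ^ 2)⁻¹ :=
            (hsum.mul_left _).tsum_le_tsum (hC F · s)
              (summable_int_one_add_abs_pow_neg_two.mul_left _)
        _ = _ := by rw [tsum_mul_left]; ring)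

lemma toCLM_apply (hφ : IsFiniteDifferenceFamily θ φ) (F : SchwartzMap ℝ ℂ) (s : ℝ) :
    hφ.toCLM F s = ∑' n : ℤ, φ n s * F (s - (n : ℝ)) := rfl

end IsFiniteDifferenceFamily

lemma exists_schwartzMap_eq_one_eq_zero {a : ℝ} (ha0 : 0 < a) (ha : a < 1 / 2) :
    ∃ χ : SchwartzMap ℝ ℂ, HasCompactSupport χ ∧ (∀ x, |x| ≤ a → χ x = 1) ∧
      ∀ x, 1 - a ≤ |x| → χ x = 0 := by
  let b : ContDiffBump (0 : ℝ) := ⟨a, 1 - a, ha0, by linarith⟩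
  have hs : HasCompactSupport (fun x => (b x : ℂ)) :=
    b.hasCompactSupport.comp_left Complex.ofReal_zero
  refine ⟨hs.toSchwartzMap (Complex.ofRealCLM.contDiff.comp b.contDiff), hs, fun x hx => ?_,
    fun x hx => ?_⟩
  · change ((b x : ℝ) : ℂ) = 1
    rw [b.one_of_mem_closedBall (by simpa using hx), Complex.ofReal_one]
  · change ((b x : ℝ) : ℂ) = 0
    rw [b.zero_of_le_dist (by rw [dist_zero_right]; exact hx), Complex.ofReal_zero]

lemma SchwartzMap.hasCompactSupport_compSubConstCLM {F : SchwartzMap ℝ ℂ}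
    (hF : HasCompactSupport F) (c : ℝ) :
    HasCompactSupport (SchwartzMap.compSubConstCLM ℂ c F) :=
  hF.comp_homeomorph (Homeomorph.subRight c)

section Commutant

variable {V : SchwartzMap ℝ ℂ →ₗ[ℂ] SchwartzMap ℝ ℂ}
  {T : SchwartzMap ℝ ℂ →L[ℂ] SchwartzMap ℝ ℂ}

/-- A linear map commuting with multiplication by `e^{2πis}` is local modulo `ℤ`. -/
lemma apply_eq_zero_of_commute
    (hV : ∀ (ξ : SchwartzMap ℝ ℂ) (s : ℝ),
      V ξ s = Complex.exp (2 * (Real.pi : ℂ) * Complex.I * (s : ℂ)) * ξ s)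
    (hTV : ∀ ξ, T (V ξ) = V (T ξ)) {F : SchwartzMap ℝ ℂ} (hF : HasCompactSupport F) {s : ℝ}
    (h : ∀ m : ℤ, F (s - (m : ℝ)) = 0) : T F s = 0 := by
  let e : ℝ → ℂ := fun x => Complex.exp (2 * (Real.pi : ℂ) * Complex.I * (x : ℂ))
  have he : ContDiff ℝ ∞ e := by
    have h1 : ContDiff ℝ ∞ (fun x : ℝ => (x : ℂ)) := Complex.ofRealCLM.contDiff
    exact (contDiff_const.mul h1).cexp
  have hπ : (2 * (Real.pi : ℂ) * Complex.I) ≠ 0 := Complex.two_pi_I_ne_zero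
  have hderiv : ∀ x, deriv (fun x => e x - e s) x = e x * (2 * (Real.pi : ℂ) * Complex.I) := by
    intro x
    have h1 : HasDerivAt (fun x : ℝ => 2 * (Real.pi : ℂ) * Complex.I * (x : ℂ))
        (2 * (Real.pi : ℂ) * Complex.I) x := by
      simpa using (Complex.ofRealCLM.hasDerivAt (x := x)).const_mul
        (2 * (Real.pi : ℂ) * Complex.I)
    exact (h1.cexp.sub_const (e s)).deriv
  have hzero : ∀ x, e x - e s = 0 → F x = 0 := by
    intro x hx
    obtain ⟨n, hn⟩ := Complex.exp_eq_exp_iff_exists_int.1 (sub_eq_zero.1 hx)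
    have h2 : (2 * (Real.pi : ℂ) * Complex.I) * (x : ℂ) =
        (2 * (Real.pi : ℂ) * Complex.I) * ((s + n : ℝ) : ℂ) := by
      rw [hn]; push_cast; ring
    have h3 : x = s - ((-n : ℤ) : ℝ) := by
      have := Complex.ofReal_injective (mul_left_cancel₀ hπ h2)
      rw [this]; push_cast; ring
    rw [h3, h]
  obtain ⟨G, hG, hFG, hsupp⟩ := exists_contDiff_mul_eq (F.smooth ⊤) (he.sub contDiff_const)
    hzero fun x _ => (hderiv x).trans_ne (mul_ne_zero (Complex.exp_ne_zero _) hπ)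
  have hGs : HasCompactSupport G := .of_support_subset_isCompact hF hsupp
  let g : SchwartzMap ℝ ℂ := hGs.toSchwartzMap hG
  have hFg : F = V g - e s • g := by
    ext x
    rw [sub_apply, smul_apply, hV, hFG x, smul_eq_mul]
    exact sub_mul _ _ _
  rw [hFg, map_sub, map_smul, hTV, sub_apply, smul_apply, hV, smul_eq_mul]
  exact sub_self _

lemma apply_eq_apply_of_commute
    (hV : ∀ (ξ : SchwartzMap ℝ ℂ) (s : ℝ),
      V ξ s = Complex.exp (2 * (Real.pi : ℂ) * Complex.I * (s : ℂ)) * ξ s)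
    (hTV : ∀ ξ, T (V ξ) = V (T ξ)) {F G : SchwartzMap ℝ ℂ} (hF : HasCompactSupport F)
    (hG : HasCompactSupport G) {s : ℝ} (h : ∀ m : ℤ, F (s - (m : ℝ)) = G (s - (m : ℝ))) :
    T F s = T G s := by
  have hFG : HasCompactSupport (F - G : SchwartzMap ℝ ℂ) := HasCompactSupport.sub hF hG
  have := apply_eq_zero_of_commute hV hTV hFG (s := s) fun m => by
    rw [sub_apply, h, sub_self]
  rwa [map_sub, sub_apply, sub_eq_zero] at this

/-- The coefficients of an operator local modulo `ℤ`, read off by testing it on the translates of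
a bump function `χ`. -/
noncomputable def differenceCoeff (T : SchwartzMap ℝ ℂ →L[ℂ] SchwartzMap ℝ ℂ)
    (χ : SchwartzMap ℝ ℂ) (n : ℤ) (s : ℝ) : ℂ :=
  T (SchwartzMap.compSubConstCLM ℂ (s - n) χ) s

variable {χ : SchwartzMap ℝ ℂ} {a : ℝ}

lemma bump_int_eq_zero (h0 : ∀ x, 1 - a ≤ |x| → χ x = 0) {m n : ℤ} (hmn : n ≠ m)
    {x : ℝ} (hx : |x| ≤ a) : χ (x + (n - m)) = 0 := by
  have h1 : (1 : ℝ) ≤ |(n : ℝ) - m| := by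
    exact_mod_cast Int.one_le_abs (sub_ne_zero.2 hmn)
  have h2 := abs_sub_abs_le_abs_sub ((n : ℝ) - m) (-x)
  rw [abs_neg, sub_neg_eq_add, add_comm _ x] at h2
  exact h0 _ (by linarith)

lemma differenceCoeff_eq (ha0 : 0 < a) (hχ : HasCompactSupport χ)
    (h1 : ∀ x, |x| ≤ a → χ x = 1) (h0 : ∀ x, 1 - a ≤ |x| → χ x = 0)
    (hV : ∀ (ξ : SchwartzMap ℝ ℂ) (s : ℝ),
      V ξ s = Complex.exp (2 * (Real.pi : ℂ) * Complex.I * (s : ℂ)) * ξ s)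
    (hTV : ∀ ξ, T (V ξ) = V (T ξ)) (n : ℤ) {s₀ s : ℝ} (hs : |s - s₀| ≤ a) :
    differenceCoeff T χ n s = T (SchwartzMap.compSubConstCLM ℂ (s₀ - n) χ) s := by
  refine apply_eq_apply_of_commute hV hTV (SchwartzMap.hasCompactSupport_compSubConstCLM hχ _)
    (SchwartzMap.hasCompactSupport_compSubConstCLM hχ _) fun m => ?_
  rw [SchwartzMap.compSubConstCLM_apply, SchwartzMap.compSubConstCLM_apply,
    show s - m - (s - n) = 0 + ((n : ℝ) - m) by ring,
    show s - m - (s₀ - n) = (s - s₀) + ((n : ℝ) - m) by ring]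
  rcases eq_or_ne n m with rfl | hnm
  · rw [sub_self, add_zero, add_zero, h1 _ hs, h1 _ (by simpa using ha0.le)]
  · rw [bump_int_eq_zero h0 hnm hs, bump_int_eq_zero h0 hnm (by simpa using ha0.le)]

lemma differenceCoeff_eventuallyEq (ha0 : 0 < a) (hχ : HasCompactSupport χ)
    (h1 : ∀ x, |x| ≤ a → χ x = 1) (h0 : ∀ x, 1 - a ≤ |x| → χ x = 0)
    (hV : ∀ (ξ : SchwartzMap ℝ ℂ) (s : ℝ),
      V ξ s = Complex.exp (2 * (Real.pi : ℂ) * Complex.I * (s : ℂ)) * ξ s)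
    (hTV : ∀ ξ, T (V ξ) = V (T ξ)) (n : ℤ) {s₀ s : ℝ} (hs : |s - s₀| < a) :
    differenceCoeff T χ n =ᶠ[𝓝 s] T (SchwartzMap.compSubConstCLM ℂ (s₀ - n) χ) := by
  have hc : Continuous fun x : ℝ => |x - s₀| := by fun_prop
  filter_upwards [hc.continuousAt.eventually_lt_const hs] with x hx
  exact differenceCoeff_eq ha0 hχ h1 h0 hV hTV n hx.le

lemma isFiniteDifferenceFamily_differenceCoeff {θ : ℝ} (hθ : 0 < θ) (ha : a < 1 / 2)
    (hθa : θ / 2 < a) (hχ : HasCompactSupport χ)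
    (h1 : ∀ x, |x| ≤ a → χ x = 1) (h0 : ∀ x, 1 - a ≤ |x| → χ x = 0)
    {U : SchwartzMap ℝ ℂ →ₗ[ℂ] SchwartzMap ℝ ℂ}
    (hU : ∀ (ξ : SchwartzMap ℝ ℂ) (s : ℝ), U ξ s = ξ (s + θ))
    (hV : ∀ (ξ : SchwartzMap ℝ ℂ) (s : ℝ),
      V ξ s = Complex.exp (2 * (Real.pi : ℂ) * Complex.I * (s : ℂ)) * ξ s)
    (hTU : ∀ ξ, T (U ξ) = U (T ξ)) (hTV : ∀ ξ, T (V ξ) = V (T ξ)) :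
    IsFiniteDifferenceFamily θ (differenceCoeff T χ) := by
  have ha0 : 0 < a := by linarith
  have hper : ∀ (n : ℤ) (s : ℝ), differenceCoeff T χ n (s + θ) = differenceCoeff T χ n s := by
    intro n s
    rw [differenceCoeff, ← hU, ← hTU, differenceCoeff]
    congr 2
    ext x
    rw [hU, SchwartzMap.compSubConstCLM_apply, SchwartzMap.compSubConstCLM_apply]
    congr 1
    ring
  refine ⟨fun n => contDiff_iff_contDiffAt.2 fun s => ?_, hper, fun k m => ?_⟩
  · exact (SchwartzMap.contDiffAt _ ⊤).congr_of_eventuallyEq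
      (differenceCoeff_eventuallyEq ha0 hχ h1 h0 hV hTV n (s₀ := s) (by simpa using ha0))
  · refine ⟨2 ^ m * (2 ^ m * (Finset.Iic (m, k)).sup
      (schwartzSeminormFamily ℂ ℝ ℂ) (T χ)), fun n s => ?_⟩
    have hperk : Function.Periodic (iteratedDeriv k (differenceCoeff T χ n)) θ := by
      intro x
      have := congrFun (iteratedDeriv_comp_add_const k (differenceCoeff T χ n) θ) x
      rw [← this, funext (hper n)]
    obtain ⟨y, hy, hsy⟩ := hperk.exists_mem_Ico hθ s (n - θ / 2)
    have hyn : |y - n| < a := by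
      rw [abs_lt]
      constructor <;> linarith [hy.1, hy.2]
    rw [hsy, (differenceCoeff_eventuallyEq ha0 hχ h1 h0 hV hTV n hyn).iteratedDeriv_eq,
      sub_self, SchwartzMap.compSubConstCLM_zero, ContinuousLinearMap.id_apply,
      ← norm_iteratedFDeriv_eq_norm_iteratedDeriv]
    have hn : 1 + |(n : ℝ)| ≤ 2 * (1 + ‖y‖) := by
      have := abs_sub_abs_le_abs_sub (n : ℝ) y
      rw [abs_sub_comm] at this
      rw [Real.norm_eq_abs]
      linarith [abs_nonneg y]
    calc (1 + |(n : ℝ)|) ^ m * ‖iteratedFDeriv ℝ k (T χ) y‖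
        ≤ (2 * (1 + ‖y‖)) ^ m * ‖iteratedFDeriv ℝ k (T χ) y‖ := by gcongr
      _ = 2 ^ m * ((1 + ‖y‖) ^ m * ‖iteratedFDeriv ℝ k (T χ) y‖) := by rw [mul_pow, mul_assoc]
      _ ≤ _ := by
          refine mul_le_mul_of_nonneg_left ?_ (by positivity)
          exact SchwartzMap.one_add_le_sup_seminorm_apply (𝕜 := ℂ) (m := (m, k)) le_rfl le_rfl (T χ) y

lemma apply_eq_tsum_differenceCoeff (ha0 : 0 < a) (hχ : HasCompactSupport χ)
    (h1 : ∀ x, |x| ≤ a → χ x = 1) (h0 : ∀ x, 1 - a ≤ |x| → χ x = 0)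
    (hV : ∀ (ξ : SchwartzMap ℝ ℂ) (s : ℝ),
      V ξ s = Complex.exp (2 * (Real.pi : ℂ) * Complex.I * (s : ℂ)) * ξ s)
    (hTV : ∀ ξ, T (V ξ) = V (T ξ)) {F : SchwartzMap ℝ ℂ} (hF : HasCompactSupport F) (s : ℝ) :
    T F s = ∑' n : ℤ, differenceCoeff T χ n s * F (s - (n : ℝ)) := by
  have hfin : {n : ℤ | F (s - (n : ℝ)) ≠ 0}.Finite := by
    have hK := hF.comp_homeomorph (Homeomorph.subLeft s)
    refine ((Int.isClosedEmbedding_coe_real.isCompact_preimage hK).finite_of_discrete).subset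
      fun n hn => subset_tsupport _ hn
  have hcs : ∀ N : Finset ℤ, HasCompactSupport
      (∑ n ∈ N, F (s - (n : ℝ)) • SchwartzMap.compSubConstCLM ℂ (s - n) χ : SchwartzMap ℝ ℂ) := by
    intro N
    induction N using Finset.cons_induction with
    | empty => exact HasCompactSupport.zero
    | cons n N hn ih =>
      rw [Finset.sum_cons]
      exact HasCompactSupport.add
        (SchwartzMap.hasCompactSupport_compSubConstCLM hχ (s - n)).smul_left ih
  rw [tsum_eq_sum (s := hfin.toFinset) fun n hn => by
      rw [Set.Finite.mem_toFinset, Set.mem_ofPred_eq, not_not] at hn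
      rw [hn, mul_zero],
    apply_eq_apply_of_commute hV hTV hF (hcs hfin.toFinset) fun m => ?_]
  · simp only [map_sum, map_smul, sum_apply, smul_apply, smul_eq_mul,
      differenceCoeff, mul_comm]
  · have hterm : ∀ n : ℤ, χ (s - m - (s - n)) = if n = m then 1 else 0 := by
      intro n
      rw [show s - m - (s - n) = 0 + ((n : ℝ) - m) by ring]
      split_ifs with hnm
      · rw [hnm, sub_self, add_zero, h1 _ (by simpa using ha0.le)]
      · exact bump_int_eq_zero h0 hnm (by simpa using ha0.le)
    simp only [sum_apply, smul_apply, SchwartzMap.compSubConstCLM_apply, hterm,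
      smul_eq_mul, mul_ite, mul_one, mul_zero, Finset.sum_ite_eq', Set.Finite.mem_toFinset,
      Set.mem_ofPred_eq]
    split_ifs with hm
    · rfl
    · exact not_not.1 hm

end Commutant

/-- the endomorphisms of the Schwartz module `S(ℝ)` over the
noncommutative torus (the continuous linear maps commuting with
`(Uξ)(s) = ξ(s+θ)` and `(Vξ)(s) = e^{2πis}ξ(s)`) are exactly the finite
difference operators `(TF)(s) = Σₙ φₙ(s)F(s-n)` with `(φₙ)` a family of smooth
`θ`-periodic functions with rapidly decaying derivatives. -/
theorem endomorphisms_eq_finite_difference_operators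
    (θ : ℝ) (hirr : Irrational θ) (hθ : θ ∈ Set.Ioo (0 : ℝ) 1)
    (U V : SchwartzMap ℝ ℂ →ₗ[ℂ] SchwartzMap ℝ ℂ)
    (hU : ∀ (ξ : SchwartzMap ℝ ℂ) (s : ℝ), U ξ s = ξ (s + θ))
    (hV : ∀ (ξ : SchwartzMap ℝ ℂ) (s : ℝ),
      V ξ s = Complex.exp (2 * (Real.pi : ℂ) * Complex.I * (s : ℂ)) * ξ s) :
    (∀ T : SchwartzMap ℝ ℂ →L[ℂ] SchwartzMap ℝ ℂ,
      (∀ ξ, T (U ξ) = U (T ξ)) → (∀ ξ, T (V ξ) = V (T ξ)) →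
      ∃ φ : ℤ → ℝ → ℂ, IsFiniteDifferenceFamily θ φ ∧
        ∀ (F : SchwartzMap ℝ ℂ) (s : ℝ),
          T F s = ∑' n : ℤ, φ n s * F (s - (n : ℝ))) ∧
    (∀ φ : ℤ → ℝ → ℂ, IsFiniteDifferenceFamily θ φ →
      ∃ T : SchwartzMap ℝ ℂ →L[ℂ] SchwartzMap ℝ ℂ,
        (∀ ξ, T (U ξ) = U (T ξ)) ∧ (∀ ξ, T (V ξ) = V (T ξ)) ∧
        ∀ (F : SchwartzMap ℝ ℂ) (s : ℝ),
          T F s = ∑' n : ℤ, φ n s * F (s - (n : ℝ))) := by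
  refine ⟨fun T hTU hTV => ?_, fun φ hφ => ⟨hφ.toCLM, fun ξ => ?_, fun ξ => ?_, hφ.toCLM_apply⟩⟩
  · obtain ⟨a, ha, ha2⟩ : ∃ a, θ / 2 < a ∧ a < 1 / 2 := exists_between (by linarith [hθ.2])
    have ha0 : 0 < a := by linarith [hθ.1]
    obtain ⟨χ, hχ, h1, h0⟩ := exists_schwartzMap_eq_one_eq_zero ha0 ha2
    have hφ := isFiniteDifferenceFamily_differenceCoeff hθ.1 ha2 ha hχ h1 h0 hU hV hTU hTV
    have hT : ⇑T = hφ.toCLM := T.continuous.ext_on SchwartzMap.dense_hasCompactSupport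
      hφ.toCLM.continuous fun F hF => SchwartzMap.ext fun s =>
        apply_eq_tsum_differenceCoeff ha0 hχ h1 h0 hV hTV hF s
    exact ⟨_, hφ, fun F s => by rw [hT, hφ.toCLM_apply]⟩
  · ext s
    rw [hU, hφ.toCLM_apply, hφ.toCLM_apply]
    refine tsum_congr fun n => ?_
    rw [hU, hφ.2.1, sub_add_eq_add_sub]
  · ext s
    rw [hV, hφ.toCLM_apply, hφ.toCLM_apply, ← tsum_mul_left]
    refine tsum_congr fun n => ?_
    have hexp : Complex.exp (2 * (Real.pi : ℂ) * Complex.I * ((s - n : ℝ) : ℂ)) =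
        Complex.exp (2 * (Real.pi : ℂ) * Complex.I * (s : ℂ)) :=
      Complex.exp_eq_exp_iff_exists_int.2 ⟨-n, by push_cast; ring⟩
    rw [hV, hexp]
    ring
end
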